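/- arXiv:2510.07250 — 3 statements merged into one kernel-verified Lean document; each statement's English description precedes it below -/
import Mathlib

section
/- Consider the Gaussian source with variance σ² and the location target with scale τ and negative log-density ψ (parameter set Θ = ℝ). Suppose ψ satisfies Assumption 2 with constants (C_ψ, C̃_ψ), and suppose N ∈ ℕ, τ, λ, σ satisfy 2N+1 ≥ C̄_ψ, τ ≥ 8e·σ·max{C̃_ψ, λ·N}, σ > 0 and λ > 0. Then: (a) for every θ ∈ ℝ, (1/2)·∫_ℝ |∫_ℝ S*_N(y|x)·u(x;θ) dx − v(y;θ)| dy ≤ C̄_ψ·exp(−(2e)^{−1}·(2N+1)^{1/(2(1+C_ψ))}); and (b) for every θ ∈ ℝ, (1/2)·∫_ℝ (|p(x) − 1| + q(x))·u(x;θ) dx ≤ 4·Err(ψ, 2N, λ). -/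
open MeasureTheory Real Filter

/-- The Gaussian source density `u(x;θ)` with standard deviation `σ`. -/
noncomputable def srcDensity (σ θ x : ℝ) : ℝ :=
  (1 / (Real.sqrt (2 * Real.pi) * σ)) * Real.exp (-(x - θ)^2 / (2 * σ^2))

/-- The location target density `v(y;θ) = (1/τ)·exp(−ψ((y−θ)/τ))`. -/
noncomputable def locDensity (ψ : ℝ → ℝ) (τ y θ : ℝ) : ℝ :=
  (1/τ) * Real.exp (-ψ ((y - θ)/τ))

/-- The weighted derivative sum `Σ_{j=1}^{n} |ψ^{(j)}(t)|/(λ^j·j!)`. -/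
noncomputable def derivSum (ψ : ℝ → ℝ) (n : ℕ) (lam t : ℝ) : ℝ :=
  ∑ j ∈ Finset.Icc 1 n, |iteratedDeriv j ψ t| / (lam^j * (Nat.factorial j : ℝ))

/-- The set `A(ψ,n,λ) = {t : Σ_{j=1}^{n} |ψ^{(j)}(t)|/(λ^j·j!) ≤ 1}`. -/
def ASet (ψ : ℝ → ℝ) (n : ℕ) (lam : ℝ) : Set ℝ :=
  {t : ℝ | derivSum ψ n lam t ≤ 1}

/-- `Err(ψ,n,λ)`. -/
noncomputable def ErrPsi (ψ : ℝ → ℝ) (n : ℕ) (lam : ℝ) : ℝ :=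
  (∫ t in (ASet ψ n lam)ᶜ, Real.exp (-ψ t)) +
    ⨆ k ∈ Finset.Icc 1 n,
      ∫ t in (ASet ψ n lam)ᶜ, Real.exp (-ψ t) * (derivSum ψ n lam t)^k

/-- `M(ψ,n,λ)`. -/
noncomputable def MPsi (ψ : ℝ → ℝ) (n : ℕ) (lam : ℝ) : ℝ :=
  ⨆ k ∈ Finset.Icc 1 n, ⨆ t : ℝ,
    Real.exp (-ψ t + ψ (t/2)) * (1 + (derivSum ψ n lam t)^k)

/-- Assumption 2 on the negative log-density `ψ` with constants `(Cψ, C̃ψ)`. -/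
structure Assumption2 (ψ : ℝ → ℝ) (Cψ : ℕ) (Ct : ℝ) : Prop where
  Ct_pos : 0 < Ct
  norm_one : ∫ t : ℝ, Real.exp (-ψ t) = 1
  sq_int : Integrable (fun t : ℝ => Real.exp (-(2 * ψ t)))
  smooth : ContDiff ℝ (⊤ : ℕ∞) ψ
  moment_int : ∀ n : ℕ, 1 ≤ n → ∀ k : ℕ, 1 ≤ k → k ≤ n →
    Integrable (fun t : ℝ => Real.exp (-ψ t) * (derivSum ψ n Ct t)^k)
  moment_le : ∀ n : ℕ, 1 ≤ n → ∀ k : ℕ, 1 ≤ k → k ≤ n →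
    ∫ t : ℝ, Real.exp (-ψ t) * (derivSum ψ n Ct t)^k ≤ (Nat.factorial (Cψ * n) : ℝ)

/-- `C̄ψ = 16π²·(2e)^{4(1+Cψ)}·e^{4(1+Cψ)²}`. -/
noncomputable def CbarPsi (Cψ : ℕ) : ℝ :=
  16 * Real.pi^2 * (2 * Real.exp 1)^(4*(1+Cψ)) * (Real.exp 1)^(4*(1+Cψ)^2)

/-- The truncated signed kernel `S*_N(y|x)`. -/
noncomputable def signedKernel (σ : ℝ) (v : ℝ → ℝ → ℝ) (N : ℕ) (y x : ℝ) : ℝ :=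
  ∑ k ∈ Finset.range (N + 1),
    ((-1 : ℝ)^k * σ^(2*k) / ((2:ℝ)^k * (Nat.factorial k : ℝ))) *
      iteratedDeriv (2*k) (fun θ => v y θ) x

/-- `p(x) = ∫ max(S*_N(y|x), 0) dy`. -/
noncomputable def pFun (σ : ℝ) (v : ℝ → ℝ → ℝ) (N : ℕ) (x : ℝ) : ℝ :=
  ∫ y : ℝ, max (signedKernel σ v N y x) 0

/-- `q(x) = −∫ min(S*_N(y|x), 0) dy`. -/
noncomputable def qFun (σ : ℝ) (v : ℝ → ℝ → ℝ) (N : ℕ) (x : ℝ) : ℝ :=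
  - ∫ y : ℝ, min (signedKernel σ v N y x) 0

/-- The Markov kernel `T*_N(y|x) = max(S*_N(y|x), 0)/p(x)`. -/
noncomputable def markovKernel (σ : ℝ) (v : ℝ → ℝ → ℝ) (N : ℕ) (y x : ℝ) : ℝ :=
  max (signedKernel σ v N y x) 0 / pFun σ v N x


/-- The standard Gaussian density. -/
noncomputable def stdGauss (z : ℝ) : ℝ := (Real.sqrt (2 * Real.pi))⁻¹ * Real.exp (-(z ^ 2 / 2))

lemma stdGauss_pos (z : ℝ) : 0 < stdGauss z := by
  unfold stdGauss; positivity

lemma hasDerivAt_stdGauss (z : ℝ) : HasDerivAt stdGauss (-z * stdGauss z) z := by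
  have h : HasDerivAt (fun z : ℝ => -(z ^ 2 / 2)) (-z) z := by
    have := ((hasDerivAt_pow 2 z).div_const 2).neg
    refine this.congr_deriv ?_
    norm_num
  refine (h.exp.const_mul (Real.sqrt (2 * Real.pi))⁻¹).congr_deriv ?_
  unfold stdGauss; ring

lemma continuous_stdGauss : Continuous stdGauss := by
  unfold stdGauss; fun_prop

lemma integrable_eval_mul_stdGauss (p : Polynomial ℝ) :
    Integrable (fun z => p.eval z * stdGauss z) := by
  induction p using Polynomial.induction_on' with
  | add p q hp hq =>
    refine (hp.add hq).congr (Eventually.of_forall fun z => ?_)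
    simp [add_mul]
  | monomial n a =>
    have h := (integrable_rpow_mul_exp_neg_mul_sq (b := 1 / 2) (by norm_num) (s := (n : ℝ))
      (by have := n.cast_nonneg (α := ℝ); linarith)).const_mul (a * (Real.sqrt (2 * Real.pi))⁻¹)
    refine h.congr (Eventually.of_forall fun z => ?_)
    simp only [Polynomial.eval_monomial, stdGauss, Real.rpow_natCast]
    rw [show -(1 / 2 : ℝ) * z ^ 2 = -(z ^ 2 / 2) by ring]
    ring

lemma integrable_stdGauss : Integrable stdGauss := by
  simpa using integrable_eval_mul_stdGauss 1

lemma integral_stdGauss : ∫ z, stdGauss z = 1 := by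
  have h := integral_gaussian (1 / 2)
  have e : ∀ z : ℝ, stdGauss z
      = (Real.sqrt (2 * Real.pi))⁻¹ * Real.exp (-(1 / 2) * z ^ 2) := fun z => by
    unfold stdGauss; congr 2; ring
  simp_rw [e]
  rw [integral_const_mul, h, show Real.pi / (1 / 2) = 2 * Real.pi by ring]
  exact inv_mul_cancel₀ (by positivity)

/-- Gaussian integration by parts against a polynomial weight. -/
lemma integral_eval_mul_stdGauss_mul_deriv (p : Polynomial ℝ) {h h' : ℝ → ℝ}
    (hd : ∀ z, HasDerivAt h (h' z) z)
    (hI : ∀ q : Polynomial ℝ, Integrable (fun z => q.eval z * stdGauss z * h z))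
    (hI' : Integrable (fun z => p.eval z * stdGauss z * h' z)) :
    ∫ z, p.eval z * stdGauss z * h' z
      = ∫ z, (Polynomial.X * p - Polynomial.derivative p).eval z * stdGauss z * h z := by
  have hu : ∀ z : ℝ, HasDerivAt (fun z => p.eval z * stdGauss z)
      (-((Polynomial.X * p - Polynomial.derivative p).eval z * stdGauss z)) z := fun z => by
    refine ((p.hasDerivAt z).mul (hasDerivAt_stdGauss z)).congr_deriv ?_
    simp; ring
  have key := integral_mul_deriv_eq_deriv_mul_of_integrable (fun z _ => hu z) (fun z _ => hd z)
    hI' (by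
      refine (hI (Polynomial.X * p - Polynomial.derivative p)).neg.congr
        (Eventually.of_forall fun z => ?_)
      simp) (hI p)
  rw [key, ← integral_neg]
  congr 1; ext z; ring

/-- The probabilists' Hermite polynomials with real coefficients. -/
noncomputable def hermiteR (n : ℕ) : Polynomial ℝ :=
  (Polynomial.hermite n).map (Int.castRingHom ℝ)

lemma hermiteR_zero : hermiteR 0 = 1 := by simp [hermiteR]

lemma hermiteR_succ (n : ℕ) :
    hermiteR (n + 1) = Polynomial.X * hermiteR n - Polynomial.derivative (hermiteR n) := by
  simp [hermiteR, Polynomial.hermite_succ, Polynomial.derivative_map]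

lemma derivative_hermiteR_succ (n : ℕ) :
    Polynomial.derivative (hermiteR (n + 1)) = ((n : Polynomial ℝ) + 1) * hermiteR n := by
  induction n with
  | zero => simp [hermiteR_succ, hermiteR_zero]
  | succ n ih =>
    rw [hermiteR_succ (n + 1), Polynomial.derivative_sub, Polynomial.derivative_mul, ih,
      Polynomial.derivative_X, Polynomial.derivative_mul]
    have e : Polynomial.derivative ((n : Polynomial ℝ) + 1) = 0 := by simp
    rw [e, hermiteR_succ n]
    push_cast; ring

lemma integral_hermiteR_sq (n : ℕ) :
    ∫ z, (hermiteR n).eval z * stdGauss z * (hermiteR n).eval z = (n.factorial : ℝ) := by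
  induction n with
  | zero => simp [hermiteR_zero, integral_stdGauss]
  | succ n ih =>
    have hI : ∀ r q : Polynomial ℝ, Integrable (fun z => q.eval z * stdGauss z * r.eval z) :=
      fun r q => by
        refine (integrable_eval_mul_stdGauss (q * r)).congr (Eventually.of_forall fun z => ?_)
        simp only [Polynomial.eval_mul]; ring
    have h := integral_eval_mul_stdGauss_mul_deriv (hermiteR n)
      (h := fun z => (hermiteR (n + 1)).eval z)
      (h' := fun z => (Polynomial.derivative (hermiteR (n + 1))).eval z)
      (fun z => Polynomial.hasDerivAt _ z) (hI _) (hI _ _)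
    rw [← hermiteR_succ, derivative_hermiteR_succ] at h
    rw [← h, Nat.factorial_succ]
    push_cast
    rw [← ih, ← integral_const_mul]
    congr 1; ext z
    simp; ring

lemma two_mul_factorial_le (k : ℕ) :
    ((2 * k).factorial : ℝ) ≤ ((2 : ℝ) ^ k * k.factorial) ^ 2 := by
  induction k with
  | zero => simp
  | succ k ih =>
    rw [show 2 * (k + 1) = 2 * k + 1 + 1 by ring, Nat.factorial_succ, Nat.factorial_succ,
      Nat.factorial_succ]
    push_cast
    have : ((2 : ℝ) ^ (k + 1) * ((k + 1) * k.factorial)) ^ 2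
        = (2 * k + 2) * (2 * k + 2) * ((2 : ℝ) ^ k * k.factorial) ^ 2 := by ring
    rw [this, show (2 * (k : ℝ) + 1 + 1) * ((2 * k + 1) * ((2 * k).factorial : ℝ))
      = (2 * k + 2) * (2 * k + 1) * ((2 * k).factorial : ℝ) by ring]
    gcongr
    norm_num

lemma integral_abs_hermiteR_le (k : ℕ) :
    ∫ z, |(hermiteR (2 * k)).eval z| * stdGauss z ≤ (2 : ℝ) ^ k * k.factorial := by
  set c : ℝ := (2 : ℝ) ^ k * k.factorial with hc
  have hc0 : 0 < c := by positivity
  have hsq : Integrable (fun z => (hermiteR (2 * k)).eval z * stdGauss z *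
      (hermiteR (2 * k)).eval z) := by
    refine (integrable_eval_mul_stdGauss (hermiteR (2 * k) * hermiteR (2 * k))).congr
      (Eventually.of_forall fun z => ?_)
    simp only [Polynomial.eval_mul]; ring
  have hle : ∫ z, |(hermiteR (2 * k)).eval z| * stdGauss z
      ≤ ∫ z, (c / 2 * stdGauss z + 1 / (2 * c) * ((hermiteR (2 * k)).eval z * stdGauss z *
      (hermiteR (2 * k)).eval z)) := by
    refine integral_mono ?_ ((integrable_stdGauss.const_mul _).add (hsq.const_mul _)) fun z => ?_
    · refine (integrable_eval_mul_stdGauss (hermiteR (2 * k))).abs.congr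
        (Eventually.of_forall fun z => ?_)
      simp [abs_mul, abs_of_pos (stdGauss_pos z)]
    · set a := (hermiteR (2 * k)).eval z
      have hg := stdGauss_pos z
      have : |a| ≤ c / 2 + 1 / (2 * c) * a ^ 2 := by
        rw [← sq_abs]
        have e : c / 2 + 1 / (2 * c) * |a| ^ 2 - |a| = (c - |a|) ^ 2 / (2 * c) := by
          field_simp; ring
        have : 0 ≤ (c - |a|) ^ 2 / (2 * c) := by positivity
        linarith
      calc |a| * stdGauss z ≤ (c / 2 + 1 / (2 * c) * a ^ 2) * stdGauss z := by gcongr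
        _ = _ := by ring
  rw [integral_add (integrable_stdGauss.const_mul _) (hsq.const_mul _), integral_const_mul,
    integral_const_mul, integral_stdGauss, integral_hermiteR_sq] at hle
  refine hle.trans ?_
  have h2 := two_mul_factorial_le k
  rw [← hc] at h2
  calc c / 2 * 1 + 1 / (2 * c) * ((2 * k).factorial : ℝ) ≤ c / 2 * 1 + 1 / (2 * c) * c ^ 2 := by
        gcongr
    _ = c := by field_simp; ring

section BoundedSmooth

lemma integrable_eval_mul_stdGauss_mul_comp {f : ℝ → ℝ} {M : ℝ} (hf : Continuous f)
    (hM : ∀ x, |f x| ≤ M) (q : Polynomial ℝ) (θ t : ℝ) :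
    Integrable (fun z => q.eval z * stdGauss z * f (θ + t * z)) :=
  (integrable_eval_mul_stdGauss q).mul_bdd (c := M) (by fun_prop)
    (Eventually.of_forall fun z => hM _)

variable {H : ℕ → ℝ → ℝ} {M : ℕ → ℝ}

/-- Derivatives of a Gaussian average can be moved onto the Gaussian, at the price of a Hermite
polynomial. -/
lemma pow_mul_integral_stdGauss_mul (hH : ∀ k x, HasDerivAt (H k) (H (k + 1) x) x)
    (hM : ∀ k x, |H k x| ≤ M k) (θ t : ℝ) (i k : ℕ) :
    t ^ i * ∫ z, stdGauss z * H (k + i) (θ + t * z)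
      = ∫ z, (hermiteR i).eval z * stdGauss z * H k (θ + t * z) := by
  have hc : ∀ k, Continuous (H k) := fun k =>
    continuous_iff_continuousAt.2 fun x => (hH k x).continuousAt
  have hd : ∀ k z, HasDerivAt (fun z => H k (θ + t * z)) (t * H (k + 1) (θ + t * z)) z :=
    fun k z => by
      have h1 : HasDerivAt (fun z : ℝ => θ + t * z) t z := by
        simpa using ((hasDerivAt_id z).const_mul t).const_add θ
      refine ((hH k (θ + t * z)).comp z h1).congr_deriv (by ring)
  induction i generalizing k with
  | zero => simp [hermiteR_zero]
  | succ i ih =>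
    have h := integral_eval_mul_stdGauss_mul_deriv (hermiteR i) (hd k)
      (fun q => integrable_eval_mul_stdGauss_mul_comp (hc k) (hM k) q θ t) (by
        refine ((integrable_eval_mul_stdGauss_mul_comp (hc (k + 1)) (hM (k + 1))
          (hermiteR i) θ t).const_mul t).congr (Eventually.of_forall fun z => ?_)
        ring)
    rw [← hermiteR_succ] at h
    rw [← h, pow_succ', mul_assoc, show k + (i + 1) = k + 1 + i by ring, ih (k + 1),
      ← integral_const_mul]
    congr 1; ext z; ring

lemma hasDerivAt_integral_stdGauss_mul (hH : ∀ k x, HasDerivAt (H k) (H (k + 1) x) x)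
    (hM : ∀ k x, |H k x| ≤ M k) (θ t : ℝ) (k : ℕ) :
    HasDerivAt (fun t => ∫ z, stdGauss z * H k (θ + t * z))
      (t * ∫ z, stdGauss z * H (k + 2) (θ + t * z)) t := by
  have hc : ∀ k, Continuous (H k) := fun k =>
    continuous_iff_continuousAt.2 fun x => (hH k x).continuousAt
  have hg := continuous_stdGauss
  have hX : Integrable (fun z => |z * stdGauss z| * M (k + 1)) := by
    have := (integrable_eval_mul_stdGauss Polynomial.X).abs.mul_const (M (k + 1))
    simpa using this
  have h := (hasDerivAt_integral_of_dominated_loc_of_deriv_le (μ := volume) (x₀ := t)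
    (F := fun t z => stdGauss z * H k (θ + t * z))
    (F' := fun t z => z * stdGauss z * H (k + 1) (θ + t * z)) (s := Set.univ)
    (bound := fun z => |z * stdGauss z| * M (k + 1)) univ_mem
    (Eventually.of_forall fun t =>
      (hg.mul ((hc k).comp (by fun_prop))).aestronglyMeasurable)
    (by simpa using integrable_eval_mul_stdGauss_mul_comp (hc k) (hM k) 1 θ t)
    ((continuous_id.mul hg).mul ((hc (k + 1)).comp (by fun_prop))).aestronglyMeasurable
    (Eventually.of_forall fun z t _ => by
      rw [Real.norm_eq_abs, abs_mul]
      exact mul_le_mul_of_nonneg_left (hM _ _) (abs_nonneg _)) hX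
    (Eventually.of_forall fun z t _ => by
      have h1 : HasDerivAt (fun t : ℝ => θ + t * z) z t := by
        simpa using ((hasDerivAt_id t).mul_const z).const_add θ
      refine (((hH k (θ + t * z)).comp t h1).const_mul (stdGauss z)).congr_deriv (by ring))).2
  refine h.congr_deriv ?_
  have h1 := pow_mul_integral_stdGauss_mul hH hM θ t 1 (k + 1)
  rw [pow_one] at h1
  rw [show k + 2 = k + 1 + 1 by ring, h1, hermiteR_succ, hermiteR_zero]
  simp

/-- The truncated backward heat expansion applied to a Gaussian average. -/
noncomputable def truncHeat (H : ℕ → ℝ → ℝ) (θ : ℝ) (N : ℕ) (t : ℝ) : ℝ :=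
  ∑ k ∈ Finset.range (N + 1), ((-1 : ℝ) ^ k * t ^ (2 * k) / ((2 : ℝ) ^ k * (k.factorial : ℝ))) *
    ∫ z, stdGauss z * H (2 * k) (θ + t * z)

lemma hasDerivAt_truncHeat (hH : ∀ k x, HasDerivAt (H k) (H (k + 1) x) x)
    (hM : ∀ k x, |H k x| ≤ M k) (θ t : ℝ) (N : ℕ) :
    HasDerivAt (truncHeat H θ N)
      ((-1 : ℝ) ^ N * t ^ (2 * N + 1) / ((2 : ℝ) ^ N * (N.factorial : ℝ)) *
        ∫ z, stdGauss z * H (2 * N + 2) (θ + t * z)) t := by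
  induction N with
  | zero =>
    have e : truncHeat H θ 0 = fun t => ∫ z, stdGauss z * H 0 (θ + t * z) := by
      ext t; simp [truncHeat]
    rw [e]
    simpa using hasDerivAt_integral_stdGauss_mul hH hM θ t 0
  | succ N ih =>
    have e : truncHeat H θ (N + 1) = fun t => truncHeat H θ N t +
        ((-1 : ℝ) ^ (N + 1) * t ^ (2 * (N + 1)) / ((2 : ℝ) ^ (N + 1) * ((N + 1).factorial : ℝ))) *
          ∫ z, stdGauss z * H (2 * (N + 1)) (θ + t * z) := by
      ext t; rw [truncHeat, Finset.sum_range_succ]; rfl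
    rw [e]
    have h1 : HasDerivAt (fun t : ℝ =>
        (-1 : ℝ) ^ (N + 1) * t ^ (2 * (N + 1)) / ((2 : ℝ) ^ (N + 1) * ((N + 1).factorial : ℝ)))
        ((-1 : ℝ) ^ (N + 1) * ((2 * (N + 1) : ℕ) * t ^ (2 * N + 1)) /
          ((2 : ℝ) ^ (N + 1) * ((N + 1).factorial : ℝ))) t :=
      ((hasDerivAt_pow (2 * (N + 1)) t).const_mul _).div_const _
    refine (ih.add (h1.mul
      (hasDerivAt_integral_stdGauss_mul hH hM θ t (2 * (N + 1))))).congr_deriv ?_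
    rw [show 2 * (N + 1) = 2 * N + 2 by ring, Nat.factorial_succ]
    push_cast
    field_simp
    ring

lemma abs_truncHeat_sub_le (hH : ∀ k x, HasDerivAt (H k) (H (k + 1) x) x)
    (hM : ∀ k x, |H k x| ≤ M k) (θ : ℝ) {σ : ℝ} (hσ : 0 ≤ σ) {N j : ℕ} (hj : 1 ≤ j)
    (hjN : j ≤ N + 1) :
    |truncHeat H θ N σ - H 0 θ| ≤
      ((N + 1 - j).factorial : ℝ) / N.factorial * (σ ^ 2 / 2) ^ j / j * M (2 * j) := by
  obtain ⟨m, rfl⟩ : ∃ m, j = m + 1 := ⟨j - 1, by omega⟩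
  obtain ⟨k, rfl⟩ : ∃ k, N = m + k := ⟨N - m, by omega⟩
  rw [show m + k + 1 - (m + 1) = k by omega]
  have hc : ∀ k, Continuous (H k) := fun k =>
    continuous_iff_continuousAt.2 fun x => (hH k x).continuousAt
  have hM0 : 0 ≤ M (2 * (m + 1)) := (abs_nonneg _).trans (hM _ 0)
  have h0 : truncHeat H θ (m + k) 0 = H 0 θ := by
    rw [truncHeat, Finset.sum_eq_single 0]
    · simp [integral_mul_const, integral_stdGauss]
    · intro b _ hb; simp [hb]
    · simp
  have hder : ∀ t : ℝ, 0 ≤ t → ‖(-1 : ℝ) ^ (m + k) * t ^ (2 * (m + k) + 1) /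
      ((2 : ℝ) ^ (m + k) * ((m + k).factorial : ℝ)) *
        ∫ z, stdGauss z * H (2 * (m + k) + 2) (θ + t * z)‖ ≤
      (k.factorial : ℝ) / ((2 : ℝ) ^ m * (m + k).factorial) * M (2 * (m + 1)) *
        t ^ (2 * m + 1) := fun t ht => by
    have h1 := pow_mul_integral_stdGauss_mul hH hM θ t (2 * k) (2 * (m + 1))
    have h2 : |∫ z, (hermiteR (2 * k)).eval z * stdGauss z * H (2 * (m + 1)) (θ + t * z)| ≤
        (2 : ℝ) ^ k * k.factorial * M (2 * (m + 1)) := by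
      refine (abs_integral_le_integral_abs).trans ?_
      have hi : Integrable (fun z => |(hermiteR (2 * k)).eval z| * stdGauss z) := by
        refine (integrable_eval_mul_stdGauss (hermiteR (2 * k))).abs.congr
          (Eventually.of_forall fun z => ?_)
        simp [abs_mul, abs_of_pos (stdGauss_pos z)]
      calc _ ≤ ∫ z, |(hermiteR (2 * k)).eval z| * stdGauss z * M (2 * (m + 1)) := by
            refine integral_mono
              (integrable_eval_mul_stdGauss_mul_comp (hc _) (hM _) _ θ t).abs
              (hi.mul_const _) fun z => ?_
            simp only [abs_mul, abs_of_pos (stdGauss_pos z)]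
            exact mul_le_mul_of_nonneg_left (hM _ _)
              (mul_nonneg (abs_nonneg _) (stdGauss_pos z).le)
        _ = (∫ z, |(hermiteR (2 * k)).eval z| * stdGauss z) * M (2 * (m + 1)) :=
            integral_mul_const _ _
        _ ≤ _ := mul_le_mul_of_nonneg_right (integral_abs_hermiteR_le k) hM0
    rw [← h1, show 2 * (m + 1) + 2 * k = 2 * (m + k) + 2 by ring] at h2
    set I := ∫ z, stdGauss z * H (2 * (m + k) + 2) (θ + t * z)
    have e : ‖(-1 : ℝ) ^ (m + k) * t ^ (2 * (m + k) + 1) /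
        ((2 : ℝ) ^ (m + k) * ((m + k).factorial : ℝ)) * I‖ =
        t ^ (2 * m + 1) / ((2 : ℝ) ^ (m + k) * ((m + k).factorial : ℝ)) * |t ^ (2 * k) * I| := by
      rw [Real.norm_eq_abs, abs_mul, abs_mul, abs_div, abs_mul, abs_pow, abs_neg, abs_one,
        one_pow, one_mul, abs_of_nonneg (pow_nonneg ht _), abs_of_nonneg (pow_nonneg ht (2 * k)),
        abs_of_pos (show (0 : ℝ) < (2 : ℝ) ^ (m + k) * ((m + k).factorial : ℝ) by positivity)]
      ring
    rw [e]
    calc _ ≤ t ^ (2 * m + 1) / ((2 : ℝ) ^ (m + k) * ((m + k).factorial : ℝ)) *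
          ((2 : ℝ) ^ k * k.factorial * M (2 * (m + 1))) := by gcongr
      _ = _ := by rw [pow_add (2 : ℝ) m k]; field_simp
  set K := (k.factorial : ℝ) / ((2 : ℝ) ^ m * (m + k).factorial) * M (2 * (m + 1)) with hK
  have key := image_norm_le_of_norm_deriv_right_le_deriv_boundary (a := 0) (b := σ)
    (f := fun t => truncHeat H θ (m + k) t - H 0 θ)
    (B := fun t => K * (t ^ (2 * m + 2) / (2 * m + 2 : ℕ)))
    (B' := fun t => K * t ^ (2 * m + 1))
    (fun t _ => ((hasDerivAt_truncHeat hH hM θ t (m + k)).continuousAt.sub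
      continuousAt_const).continuousWithinAt)
    (fun t _ => ((hasDerivAt_truncHeat hH hM θ t (m + k)).sub_const _).hasDerivWithinAt)
    (by simp [h0])
    (fun t => by
      refine (((hasDerivAt_pow (2 * m + 2) t).div_const _).const_mul K).congr_deriv ?_
      push_cast
      field_simp)
    (fun t ht => hder t ht.1) (Set.right_mem_Icc.2 hσ)
  refine key.trans (le_of_eq ?_)
  rw [hK]
  push_cast
  rw [div_pow, ← pow_mul, show 2 * (m + 1) = 2 * m + 2 by ring, pow_succ (2 : ℝ) m]
  field_simp

end BoundedSmooth

lemma integral_mul_srcDensity {σ : ℝ} (hσ : 0 < σ) (θ : ℝ) (F : ℝ → ℝ) :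
    ∫ x, F x * srcDensity σ θ x = ∫ z, stdGauss z * F (θ + σ * z) := by
  have e : ∀ z, stdGauss z * F (θ + σ * z)
      = σ * ((fun w => F (θ + w) * srcDensity σ θ (θ + w)) (σ * z)) := fun z => by
    simp only [stdGauss, srcDensity]
    rw [show -(θ + σ * z - θ) ^ 2 / (2 * σ ^ 2) = -(z ^ 2 / 2) by field_simp; ring]
    field_simp
  rw [integral_congr_ae (Eventually.of_forall e), integral_const_mul,
    Measure.integral_comp_mul_left (fun w => F (θ + w) * srcDensity σ θ (θ + w)) σ,
    integral_add_left_eq_self (fun x => F x * srcDensity σ θ x) θ, smul_eq_mul,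
    abs_of_pos (inv_pos.2 hσ)]
  field_simp

lemma srcDensity_eq {σ : ℝ} (hσ : 0 < σ) (θ x : ℝ) :
    srcDensity σ θ x = σ⁻¹ * stdGauss ((x - θ) / σ) := by
  simp only [stdGauss, srcDensity]
  rw [show -(x - θ) ^ 2 / (2 * σ ^ 2) = -(((x - θ) / σ) ^ 2 / 2) by field_simp]
  field_simp

lemma continuous_srcDensity (σ θ : ℝ) : Continuous (srcDensity σ θ) := by
  unfold srcDensity; fun_prop

lemma srcDensity_nonneg {σ : ℝ} (hσ : 0 < σ) (θ x : ℝ) : 0 ≤ srcDensity σ θ x := by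
  unfold srcDensity; positivity

lemma integrable_srcDensity {σ : ℝ} (hσ : 0 < σ) (θ : ℝ) : Integrable (srcDensity σ θ) := by
  have h := ((integrable_stdGauss.comp_div hσ.ne').comp_sub_right θ).const_mul σ⁻¹
  exact h.congr (Eventually.of_forall fun x => (srcDensity_eq hσ θ x).symm)

lemma integral_srcDensity {σ : ℝ} (hσ : 0 < σ) (θ : ℝ) : ∫ x, srcDensity σ θ x = 1 := by
  simpa [integral_stdGauss] using integral_mul_srcDensity hσ θ (fun _ => 1)

section Smoothing

variable {b : ℝ → ℝ}

lemma integrable_bdd_mul_comp_sub {G u : ℝ → ℝ} {ν : Measure ℝ} [SFinite ν]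
    (hb : Measurable b) (hb1 : ∀ y, |b y| ≤ 1) (hG : Integrable G) (hu : Integrable u ν) :
    Integrable (fun p : ℝ × ℝ => b p.1 * (G (p.1 - p.2) * u p.2)) (volume.prod ν) := by
  have h := hu.convolution_integrand (ContinuousLinearMap.mul ℝ ℝ) hG
  refine (h.bdd_mul (c := 1) (hb.comp measurable_fst).aestronglyMeasurable
    (Eventually.of_forall fun p => hb1 _)).congr (Eventually.of_forall fun p => ?_)
  simp [mul_comm]

lemma integral_bdd_mul_comp_sub {G G' : ℝ → ℝ} (hb : Measurable b) (hb1 : ∀ y, |b y| ≤ 1)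
    (hGd : ∀ x, HasDerivAt G (G' x) x) (hG : Integrable G) (hG' : Integrable G')
    (hGc : Continuous G') (x : ℝ) :
    IntervalIntegrable (fun s => ∫ y, b y * G' (y - s)) volume 0 x ∧
      ∫ y, b y * G (y - x)
        = (∫ y, b y * G y) - ∫ s in (0 : ℝ)..x, ∫ y, b y * G' (y - s) := by
  have hu : Integrable (fun _ : ℝ => (1 : ℝ)) (volume.restrict (Set.uIoc 0 x)) :=
    integrableOn_const (by simp)
  have hI := integrable_bdd_mul_comp_sub hb hb1 hG' hu
  simp only [mul_one] at hI
  have hbG : ∀ s, Integrable (fun y => b y * G (y - s)) := fun s =>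
    (hG.comp_sub_right s).bdd_mul (c := 1) hb.aestronglyMeasurable (Eventually.of_forall hb1)
  refine ⟨intervalIntegrable_iff.2 hI.integral_prod_right, ?_⟩
  have hI' : Integrable (Function.uncurry fun s y => b y * G' (y - s))
      ((volume.restrict (Set.uIoc 0 x)).prod volume) := hI.swap
  have hsw : ∫ s in (0 : ℝ)..x, ∫ y, b y * G' (y - s)
      = ∫ y, ∫ s in (0 : ℝ)..x, b y * G' (y - s) := by
    rw [intervalIntegral.intervalIntegral_eq_integral_uIoc, integral_integral_swap hI']
    simp_rw [intervalIntegral.intervalIntegral_eq_integral_uIoc]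
    rw [integral_smul]
  have hin : ∀ y, ∫ s in (0 : ℝ)..x, b y * G' (y - s) = b y * G y - b y * G (y - x) := fun y => by
    have hd : ∀ s ∈ Set.uIcc 0 x,
        HasDerivAt (fun s => -(b y * G (y - s))) (b y * G' (y - s)) s := fun s _ => by
      have h1 : HasDerivAt (fun s : ℝ => y - s) (-1) s := by
        simpa using (hasDerivAt_id s).const_sub y
      refine (((hGd (y - s)).comp s h1).const_mul (b y)).neg.congr_deriv (by ring)
    rw [intervalIntegral.integral_eq_sub_of_hasDerivAt hd
      (Continuous.intervalIntegrable (by fun_prop) _ _)]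
    simp; ring
  rw [hsw]
  simp_rw [hin]
  have h0 := hbG 0
  simp only [sub_zero] at h0
  rw [integral_sub h0 (hbG x)]
  ring

lemma hasDerivAt_integral_bdd_mul {G G' G'' : ℝ → ℝ} (hb : Measurable b) (hb1 : ∀ y, |b y| ≤ 1)
    (hGd : ∀ x, HasDerivAt G (G' x) x) (hGd' : ∀ x, HasDerivAt G' (G'' x) x)
    (hG : Integrable G) (hG' : Integrable G') (hG'' : Integrable G'') (hGc : Continuous G'')
    (x : ℝ) :
    HasDerivAt (fun x => ∫ y, b y * G (y - x)) (-∫ y, b y * G' (y - x)) x := by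
  have hGc' : Continuous G' := continuous_iff_continuousAt.2 fun x => (hGd' x).continuousAt
  have hcont : Continuous (fun s => ∫ y, b y * G' (y - s)) := by
    have h := fun x => integral_bdd_mul_comp_sub hb hb1 hGd' hG' hG'' hGc x
    have e : (fun s => ∫ y, b y * G' (y - s)) = fun x => (∫ y, b y * G' y) -
        ∫ s in (0 : ℝ)..x, ∫ y, b y * G'' (y - s) := funext fun x => (h x).2
    rw [e]
    exact continuous_const.sub (intervalIntegral.continuous_primitive
      (fun a c => (h a).1.symm.trans (h c).1) 0)
  have e : (fun x => ∫ y, b y * G (y - x)) = fun x => (∫ y, b y * G y) -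
      ∫ s in (0 : ℝ)..x, ∫ y, b y * G' (y - s) :=
    funext fun x => (integral_bdd_mul_comp_sub hb hb1 hGd hG hG' hGc' x).2
  rw [e]
  exact (hcont.integral_hasStrictDerivAt 0 x).hasDerivAt.const_sub _

/-- `L¹` bound for the truncated backward heat expansion composed with Gaussian smoothing. -/
lemma integral_abs_truncated_sub_le {g : ℕ → ℝ → ℝ}
    (hg : ∀ k x, HasDerivAt (g k) (g (k + 1) x) x) (hgi : ∀ k, Integrable (g k))
    {σ : ℝ} (hσ : 0 < σ) (θ : ℝ) {N j : ℕ} (hj : 1 ≤ j) (hjN : j ≤ N + 1) :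
    ∫ y, |(∑ k ∈ Finset.range (N + 1),
        ((-1 : ℝ) ^ k * σ ^ (2 * k) / ((2 : ℝ) ^ k * (k.factorial : ℝ))) *
          ∫ x, g (2 * k) (y - x) * srcDensity σ θ x) - g 0 (y - θ)|
      ≤ ((N + 1 - j).factorial : ℝ) / N.factorial * (σ ^ 2 / 2) ^ j / j *
        ∫ y, |g (2 * j) y| := by
  have hgc : ∀ k, Continuous (g k) := fun k =>
    continuous_iff_continuousAt.2 fun x => (hg k x).continuousAt
  have hu := integrable_srcDensity hσ θ
  have huc := continuous_srcDensity σ θ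
  set c : ℕ → ℝ := fun k => (-1 : ℝ) ^ k * σ ^ (2 * k) / ((2 : ℝ) ^ k * (k.factorial : ℝ)) with hc
  set E : ℝ → ℝ := fun y => (∑ k ∈ Finset.range (N + 1),
    c k * ∫ x, g (2 * k) (y - x) * srcDensity σ θ x) - g 0 (y - θ) with hE
  have hEm : Measurable E := by
    refine Measurable.sub (Finset.measurable_sum _ fun k _ => Measurable.const_mul ?_ _)
      ((hgc 0).comp (by fun_prop)).measurable
    have : Continuous (Function.uncurry fun y x => g (2 * k) (y - x) * srcDensity σ θ x) :=
      ((hgc (2 * k)).comp (by fun_prop)).mul (huc.comp continuous_snd)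
    exact this.stronglyMeasurable.integral_prod_right.measurable
  set b : ℝ → ℝ := fun y => if 0 ≤ E y then 1 else -1 with hbdef
  have hb : Measurable b :=
    Measurable.ite (measurableSet_le measurable_const hEm) measurable_const measurable_const
  have hb1 : ∀ y, |b y| ≤ 1 := fun y => by
    simp only [hbdef]; split_ifs <;> simp
  have hbE : ∀ y, |E y| = b y * E y := fun y => by
    simp only [hbdef]; split_ifs with h
    · rw [abs_of_nonneg h, one_mul]
    · rw [abs_of_neg (not_le.1 h), neg_one_mul]
  set H : ℕ → ℝ → ℝ := fun k x => (-1 : ℝ) ^ k * ∫ y, b y * g k (y - x) with hHdef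
  have hH : ∀ k x, HasDerivAt (H k) (H (k + 1) x) x := fun k x => by
    refine ((hasDerivAt_integral_bdd_mul hb hb1 (hg k) (hg (k + 1)) (hgi k) (hgi (k + 1))
      (hgi (k + 2)) (hgc (k + 2)) x).const_mul ((-1 : ℝ) ^ k)).congr_deriv ?_
    simp only [hHdef]; ring
  have hM : ∀ k x, |H k x| ≤ ∫ y, |g k y| := fun k x => by
    simp only [hHdef]
    rw [abs_mul, abs_pow, abs_neg, abs_one, one_pow, one_mul,
      ← integral_sub_right_eq_self (fun y => |g k y|) x]
    refine abs_integral_le_integral_abs.trans (integral_mono ?_ ?_ fun y => ?_)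
    · exact (((hgi k).comp_sub_right x).bdd_mul (c := 1) hb.aestronglyMeasurable
        (Eventually.of_forall hb1)).abs
    · exact ((hgi k).comp_sub_right x).abs
    · simp only [abs_mul]
      exact mul_le_of_le_one_left (abs_nonneg _) (hb1 y)
  have hpair : ∀ k, Integrable (fun p : ℝ × ℝ =>
      b p.1 * (g (2 * k) (p.1 - p.2) * srcDensity σ θ p.2)) := fun k =>
    integrable_bdd_mul_comp_sub hb hb1 (hgi (2 * k)) hu
  have hterm : ∀ k, Integrable (fun y =>
      c k * ∫ x, b y * (g (2 * k) (y - x) * srcDensity σ θ x)) := fun k =>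
    (hpair k).integral_prod_left.const_mul (c k)
  have hval : ∀ k, ∫ y, ∫ x, b y * (g (2 * k) (y - x) * srcDensity σ θ x)
      = ∫ z, stdGauss z * H (2 * k) (θ + σ * z) := fun k => by
    rw [integral_integral_swap (hpair k), ← integral_mul_srcDensity hσ θ (H (2 * k))]
    congr 1; ext x
    simp only [hHdef]
    rw [pow_mul, neg_one_sq, one_pow, one_mul, ← integral_mul_const]
    congr 1; ext y; ring
  have h0 : Integrable (fun y => b y * g 0 (y - θ)) :=
    ((hgi 0).comp_sub_right θ).bdd_mul (c := 1) hb.aestronglyMeasurable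
      (Eventually.of_forall hb1)
  have key : ∫ y, |E y| = truncHeat H θ N σ - H 0 θ := by
    have e : ∀ y, |E y| = (∑ k ∈ Finset.range (N + 1),
        c k * ∫ x, b y * (g (2 * k) (y - x) * srcDensity σ θ x)) - b y * g 0 (y - θ) := fun y => by
      rw [hbE]
      change b y * ((∑ k ∈ Finset.range (N + 1),
        c k * ∫ x, g (2 * k) (y - x) * srcDensity σ θ x) - g 0 (y - θ)) = _
      rw [mul_sub, Finset.mul_sum]
      congr 1
      refine Finset.sum_congr rfl fun k _ => ?_
      rw [integral_const_mul]; ring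
    simp_rw [e]
    rw [integral_sub (integrable_finsetSum _ fun k _ => hterm k) h0,
      integral_finsetSum _ fun k _ => hterm k]
    simp_rw [integral_const_mul (c _), hval]
    simp [truncHeat, hc, hHdef]
  have := abs_truncHeat_sub_le hH hM θ hσ.le hj hjN
  rw [key]
  exact (le_abs_self _).trans this

end Smoothing

section LocationFamily

variable {ψ : ℝ → ℝ}

lemma derivSum_nonneg (ψ : ℝ → ℝ) (n : ℕ) {lam : ℝ} (hlam : 0 < lam) (t : ℝ) :
    0 ≤ derivSum ψ n lam t :=
  Finset.sum_nonneg fun j _ => by positivity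

lemma continuous_derivSum (hψ : ContDiff ℝ (⊤ : ℕ∞) ψ) (n : ℕ) (lam : ℝ) :
    Continuous (derivSum ψ n lam) := by
  unfold derivSum
  refine continuous_finsetSum _ fun j _ => ?_
  have : Continuous (iteratedDeriv j ψ) := hψ.continuous_iteratedDeriv j (by exact_mod_cast le_top)
  fun_prop

lemma contDiff_exp_neg (hψ : ContDiff ℝ (⊤ : ℕ∞) ψ) :
    ContDiff ℝ (⊤ : ℕ∞) (fun t => Real.exp (-ψ t)) := hψ.neg.exp

lemma iteratedDeriv_succ_exp_neg (hψ : ContDiff ℝ (⊤ : ℕ∞) ψ) (n : ℕ) (t : ℝ) :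
    iteratedDeriv (n + 1) (fun t => Real.exp (-ψ t)) t
      = -∑ i ∈ Finset.range (n + 1), (n.choose i : ℝ) * iteratedDeriv (i + 1) ψ t *
          iteratedDeriv (n - i) (fun t => Real.exp (-ψ t)) t := by
  have hd : deriv (fun t => Real.exp (-ψ t))
      = -(deriv ψ * fun t => Real.exp (-ψ t)) := by
    ext t
    have h : HasDerivAt ψ (deriv ψ t) t :=
      (hψ.differentiable (by simp)).differentiableAt.hasDerivAt
    refine h.neg.exp.deriv.trans ?_
    simp; ring
  have hdψ : ContDiff ℝ (⊤ : ℕ∞) (deriv ψ) := hψ.iterate_deriv 1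
  rw [iteratedDeriv_succ', hd, iteratedDeriv_neg,
    iteratedDeriv_mul ((hdψ.of_le (by exact_mod_cast le_top)).contDiffAt)
      (((contDiff_exp_neg hψ).of_le (by exact_mod_cast le_top)).contDiffAt)]
  simp_rw [← iteratedDeriv_succ']

/-- The derivatives of `e^{-ψ}` are controlled by powers of the weighted derivative sum. -/
lemma abs_iteratedDeriv_exp_neg_le (hψ : ContDiff ℝ (⊤ : ℕ∞) ψ) {lam : ℝ} (hlam : 0 < lam)
    (m : ℕ) (t : ℝ) (n : ℕ) (hn : 1 ≤ n) (hnm : n ≤ m) :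
    |iteratedDeriv n (fun t => Real.exp (-ψ t)) t| ≤ n.factorial * lam ^ n * Real.exp (-ψ t) *
      max (derivSum ψ m lam t) (derivSum ψ m lam t ^ n) := by
  set D := derivSum ψ m lam t with hD
  have hD0 : 0 ≤ D := derivSum_nonneg ψ m hlam t
  have hf := Real.exp_pos (-ψ t)
  induction n using Nat.strong_induction_on with
  | _ n ih =>
    obtain ⟨n, rfl⟩ : ∃ k, n = k + 1 := ⟨n - 1, by omega⟩
    have hlow : ∀ i ≤ n, |iteratedDeriv i (fun t => Real.exp (-ψ t)) t| ≤
        i.factorial * lam ^ i * Real.exp (-ψ t) * max 1 (D ^ n) := fun i hi => by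
      rcases Nat.eq_zero_or_pos i with rfl | h
      · simpa [abs_of_pos hf] using le_mul_of_one_le_right hf.le (le_max_left 1 (D ^ n))
      · refine (ih i (by omega) h (by omega)).trans ?_
        refine mul_le_mul_of_nonneg_left ?_ (by positivity)
        rcases le_total D 1 with h1 | h1
        · exact (max_le h1 (pow_le_one₀ hD0 h1)).trans (le_max_left _ _)
        · exact (max_le (le_self_pow₀ h1 (by omega)) (pow_le_pow_right₀ h1 hi)).trans
            (le_max_right _ _)
    have hsum : ∑ i ∈ Finset.range (n + 1),
        |iteratedDeriv (i + 1) ψ t| / (lam ^ (i + 1) * ((i + 1).factorial : ℝ)) ≤ D := by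
      rw [hD, derivSum, Finset.range_eq_Ico,
        Finset.sum_Ico_add' (fun j => |iteratedDeriv j ψ t| / (lam ^ j * (j.factorial : ℝ))) 0
          (n + 1) 1]
      refine Finset.sum_le_sum_of_subset_of_nonneg (fun j hj => ?_) fun j _ _ => by positivity
      simp only [Finset.mem_Ico, Finset.mem_Icc] at hj ⊢
      omega
    rw [iteratedDeriv_succ_exp_neg hψ, abs_neg]
    calc |∑ i ∈ Finset.range (n + 1), (n.choose i : ℝ) * iteratedDeriv (i + 1) ψ t *
          iteratedDeriv (n - i) (fun t => Real.exp (-ψ t)) t|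
        ≤ ∑ i ∈ Finset.range (n + 1), |(n.choose i : ℝ) * iteratedDeriv (i + 1) ψ t *
          iteratedDeriv (n - i) (fun t => Real.exp (-ψ t)) t| := Finset.abs_sum_le_sum_abs _ _
      _ ≤ ∑ i ∈ Finset.range (n + 1), ((n + 1).factorial * lam ^ (n + 1) * Real.exp (-ψ t) *
          max 1 (D ^ n)) *
            (|iteratedDeriv (i + 1) ψ t| / (lam ^ (i + 1) * ((i + 1).factorial : ℝ))) := by
          refine Finset.sum_le_sum fun i hi => ?_
          have hin : i ≤ n := by simpa [Nat.lt_succ_iff] using hi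
          rw [abs_mul, abs_mul, Nat.abs_cast]
          calc _ ≤ (n.choose i : ℝ) * |iteratedDeriv (i + 1) ψ t| *
              ((n - i).factorial * lam ^ (n - i) * Real.exp (-ψ t) * max 1 (D ^ n)) := by
                gcongr
                exact hlow (n - i) (by omega)
            _ = ((n.choose i * (i + 1).factorial * (n - i).factorial : ℕ) : ℝ) *
                (lam ^ (n + 1) * Real.exp (-ψ t) * max 1 (D ^ n) *
                  (|iteratedDeriv (i + 1) ψ t| / (lam ^ (i + 1) * ((i + 1).factorial : ℝ)))) := by
                have : lam ^ (n + 1) = lam ^ (n - i) * lam ^ (i + 1) := by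
                  rw [← pow_add]; congr 1; omega
                rw [this]
                push_cast
                field_simp
            _ ≤ ((n + 1).factorial : ℝ) *
                (lam ^ (n + 1) * Real.exp (-ψ t) * max 1 (D ^ n) *
                  (|iteratedDeriv (i + 1) ψ t| / (lam ^ (i + 1) * ((i + 1).factorial : ℝ)))) := by
                have hnat : n.choose i * (i + 1).factorial * (n - i).factorial
                    ≤ (n + 1).factorial := by
                  rw [Nat.factorial_succ i, Nat.factorial_succ n,
                    ← Nat.choose_mul_factorial_mul_factorial hin]
                  calc _ = (i + 1) * (n.choose i * i.factorial * (n - i).factorial) := by ring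
                    _ ≤ _ := Nat.mul_le_mul_right _ (by omega)
                have hmax : 0 ≤ max 1 (D ^ n) := zero_le_one.trans (le_max_left _ _)
                gcongr
            _ = _ := by ring
      _ ≤ ((n + 1).factorial * lam ^ (n + 1) * Real.exp (-ψ t) * max 1 (D ^ n)) * D := by
          rw [← Finset.mul_sum]
          have hmax : 0 ≤ max 1 (D ^ n) := zero_le_one.trans (le_max_left _ _)
          gcongr
      _ = _ := by
          rw [mul_assoc, max_mul_of_nonneg _ _ hD0, one_mul, ← pow_succ]

namespace Assumption2

variable {Cψ : ℕ} {Ct : ℝ}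

lemma integrable_exp_neg (hψ : Assumption2 ψ Cψ Ct) : Integrable (fun t => Real.exp (-ψ t)) := by
  by_contra h
  have := integral_undef h
  rw [hψ.norm_one] at this
  exact one_ne_zero this

lemma integrable_exp_neg_mul_derivSum_pow (hψ : Assumption2 ψ Cψ Ct) {lam : ℝ} (hlam : 0 < lam)
    {n k : ℕ} (hk : 1 ≤ k) (hkn : k ≤ n) :
    Integrable (fun t => Real.exp (-ψ t) * derivSum ψ n lam t ^ k) := by
  have hCt := hψ.Ct_pos
  set R := max 1 (Ct / lam) ^ n with hR
  have hle : ∀ t, derivSum ψ n lam t ≤ R * derivSum ψ n Ct t := fun t => by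
    unfold derivSum
    rw [Finset.mul_sum]
    refine Finset.sum_le_sum fun j hj => ?_
    have h1 : (Ct / lam) ^ j ≤ R :=
      (pow_le_pow_left₀ (by positivity) (le_max_right 1 _) j).trans
        (pow_le_pow_right₀ (le_max_left _ _) (Finset.mem_Icc.1 hj).2)
    calc |iteratedDeriv j ψ t| / (lam ^ j * (j.factorial : ℝ))
        = (Ct / lam) ^ j * (|iteratedDeriv j ψ t| / (Ct ^ j * (j.factorial : ℝ))) := by
          rw [div_pow]; field_simp
      _ ≤ _ := by gcongr
  refine ((hψ.moment_int n (hk.trans hkn) k hk hkn).const_mul (R ^ k)).mono'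
    ((hψ.smooth.continuous.neg.rexp.mul
      ((continuous_derivSum hψ.smooth n lam).pow k)).aestronglyMeasurable)
    (Eventually.of_forall fun t => ?_)
  have h0 := derivSum_nonneg ψ n hlam t
  rw [Real.norm_eq_abs, abs_of_nonneg (by positivity)]
  calc Real.exp (-ψ t) * derivSum ψ n lam t ^ k
      ≤ Real.exp (-ψ t) * (R * derivSum ψ n Ct t) ^ k := by gcongr; exact hle t
    _ = _ := by rw [mul_pow]; ring

lemma abs_iteratedDeriv_le (hψ : Assumption2 ψ Cψ Ct) {n : ℕ} (hn : 1 ≤ n) (t : ℝ) :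
    |iteratedDeriv n (fun t => Real.exp (-ψ t)) t| ≤ n.factorial * Ct ^ n *
      (Real.exp (-ψ t) * derivSum ψ n Ct t ^ 1 + Real.exp (-ψ t) * derivSum ψ n Ct t ^ n) := by
  have h0 := derivSum_nonneg ψ n hψ.Ct_pos t
  have hCt := hψ.Ct_pos
  refine (abs_iteratedDeriv_exp_neg_le hψ.smooth hψ.Ct_pos n t n hn le_rfl).trans ?_
  rw [← mul_add, ← mul_assoc, pow_one]
  gcongr
  exact max_le_add_of_nonneg h0 (pow_nonneg h0 n)

lemma integrable_iteratedDeriv (hψ : Assumption2 ψ Cψ Ct) (n : ℕ) :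
    Integrable (iteratedDeriv n (fun t => Real.exp (-ψ t))) := by
  rcases Nat.eq_zero_or_pos n with rfl | hn
  · simpa using hψ.integrable_exp_neg
  · exact (((hψ.moment_int n hn 1 le_rfl hn).add (hψ.moment_int n hn n hn le_rfl)).const_mul
      (n.factorial * Ct ^ n)).mono'
      (((contDiff_exp_neg hψ.smooth).continuous_iteratedDeriv n
        (by exact_mod_cast le_top)).aestronglyMeasurable)
      (Eventually.of_forall fun t => hψ.abs_iteratedDeriv_le hn t)

lemma integral_abs_iteratedDeriv_le (hψ : Assumption2 ψ Cψ Ct) {n : ℕ} (hn : 1 ≤ n) :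
    ∫ t, |iteratedDeriv n (fun t => Real.exp (-ψ t)) t|
      ≤ 2 * (n.factorial * Ct ^ n * (Cψ * n).factorial) := by
  have h1 := hψ.moment_int n hn 1 le_rfl hn
  have h2 := hψ.moment_int n hn n hn le_rfl
  have hCt := hψ.Ct_pos
  calc _ ≤ ∫ t, n.factorial * Ct ^ n *
      (Real.exp (-ψ t) * derivSum ψ n Ct t ^ 1 + Real.exp (-ψ t) * derivSum ψ n Ct t ^ n) :=
        integral_mono (hψ.integrable_iteratedDeriv n).abs ((h1.add h2).const_mul _)
          fun t => hψ.abs_iteratedDeriv_le hn t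
    _ = n.factorial * Ct ^ n * ((∫ t, Real.exp (-ψ t) * derivSum ψ n Ct t ^ 1) +
        ∫ t, Real.exp (-ψ t) * derivSum ψ n Ct t ^ n) := by
        rw [integral_const_mul, integral_add h1 h2]
    _ ≤ n.factorial * Ct ^ n * ((Cψ * n).factorial + (Cψ * n).factorial) := by
        gcongr
        · exact hψ.moment_le n hn 1 le_rfl hn
        · exact hψ.moment_le n hn n hn le_rfl
    _ = _ := by ring

end Assumption2

/-- The `k`-th derivative of the rescaled density `τ⁻¹·e^{-ψ(·/τ)}`. -/
noncomputable def scaledDeriv (ψ : ℝ → ℝ) (τ : ℝ) (k : ℕ) (z : ℝ) : ℝ :=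
  τ⁻¹ ^ (k + 1) * iteratedDeriv k (fun t => Real.exp (-ψ t)) (z / τ)

lemma hasDerivAt_iteratedDeriv_exp_neg (hψ : ContDiff ℝ (⊤ : ℕ∞) ψ) (k : ℕ) (t : ℝ) :
    HasDerivAt (iteratedDeriv k (fun t => Real.exp (-ψ t)))
      (iteratedDeriv (k + 1) (fun t => Real.exp (-ψ t)) t) t := by
  rw [iteratedDeriv_succ]
  exact (((contDiff_exp_neg hψ).differentiable_iteratedDeriv k
    (by exact_mod_cast ENat.natCast_lt_top k))).differentiableAt.hasDerivAt

lemma hasDerivAt_scaledDeriv (hψ : ContDiff ℝ (⊤ : ℕ∞) ψ) (τ : ℝ) (k : ℕ) (z : ℝ) :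
    HasDerivAt (scaledDeriv ψ τ k) (scaledDeriv ψ τ (k + 1) z) z := by
  have h1 := hasDerivAt_iteratedDeriv_exp_neg hψ k (z / τ)
  have h2 : HasDerivAt (fun z : ℝ => z / τ) (1 / τ) z := (hasDerivAt_id z).div_const τ
  refine ((h1.comp z h2).const_mul (τ⁻¹ ^ (k + 1))).congr_deriv ?_
  unfold scaledDeriv; ring

lemma locDensity_eq (ψ : ℝ → ℝ) (τ y θ : ℝ) :
    locDensity ψ τ y θ = scaledDeriv ψ τ 0 (y - θ) := by
  simp [locDensity, scaledDeriv]

lemma iteratedDeriv_locDensity (hψ : ContDiff ℝ (⊤ : ℕ∞) ψ) (τ y : ℝ) (k : ℕ) (x : ℝ) :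
    iteratedDeriv k (fun θ => locDensity ψ τ y θ) x
      = (-1) ^ k * scaledDeriv ψ τ k (y - x) := by
  induction k generalizing x with
  | zero => simp [locDensity_eq]
  | succ k ih =>
    rw [iteratedDeriv_succ, funext ih]
    have h1 : HasDerivAt (fun x : ℝ => y - x) (-1) x := by
      simpa using (hasDerivAt_id x).const_sub y
    refine (((hasDerivAt_scaledDeriv hψ τ k (y - x)).comp x h1).const_mul
      ((-1 : ℝ) ^ k)).deriv.trans ?_
    ring

lemma Assumption2.integrable_scaledDeriv {Cψ : ℕ} {Ct τ : ℝ} (hψ : Assumption2 ψ Cψ Ct)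
    (hτ : 0 < τ) (k : ℕ) : Integrable (scaledDeriv ψ τ k) :=
  ((hψ.integrable_iteratedDeriv k).comp_div hτ.ne').const_mul _

lemma integral_abs_scaledDeriv {τ : ℝ} (hτ : 0 < τ) (k : ℕ) :
    ∫ z, |scaledDeriv ψ τ k z|
      = τ⁻¹ ^ k * ∫ t, |iteratedDeriv k (fun t => Real.exp (-ψ t)) t| := by
  simp only [scaledDeriv, abs_mul, abs_pow, abs_inv, abs_of_pos hτ]
  rw [integral_const_mul,
    Measure.integral_comp_div (fun t => |iteratedDeriv k (fun t => Real.exp (-ψ t)) t|) τ,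
    smul_eq_mul, abs_of_pos hτ, pow_succ]
  field_simp

lemma signedKernel_locDensity (hψ : ContDiff ℝ (⊤ : ℕ∞) ψ) (σ τ : ℝ) (N : ℕ) (y x : ℝ) :
    signedKernel σ (locDensity ψ τ) N y x = ∑ k ∈ Finset.range (N + 1),
      ((-1 : ℝ) ^ k * σ ^ (2 * k) / ((2 : ℝ) ^ k * (k.factorial : ℝ))) *
        scaledDeriv ψ τ (2 * k) (y - x) := by
  unfold signedKernel
  refine Finset.sum_congr rfl fun k _ => ?_
  rw [iteratedDeriv_locDensity hψ, pow_mul (-1 : ℝ) 2 k]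
  simp

end LocationFamily

section Normalization

variable {ψ : ℝ → ℝ} {Cψ : ℕ} {Ct σ τ lam : ℝ} {N : ℕ}

lemma le_iSup_mem_Icc {F : ℕ → ℝ} (hF : ∀ k, 0 ≤ F k) {n k : ℕ} (hk : k ∈ Finset.Icc 1 n) :
    F k ≤ ⨆ k ∈ Finset.Icc 1 n, F k := by
  have hb : BddAbove (Set.range fun k => ⨆ _ : k ∈ Finset.Icc 1 n, F k) := by
    refine ⟨∑ i ∈ Finset.Icc 1 n, F i, ?_⟩
    rintro _ ⟨i, rfl⟩
    by_cases hi : i ∈ Finset.Icc 1 n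
    · simp only [hi, ciSup_unique]
      exact Finset.single_le_sum (fun j _ => hF j) hi
    · simp only [hi, Real.iSup_of_isEmpty]
      exact Finset.sum_nonneg fun j _ => hF j
  refine le_ciSup_of_le hb k ?_
  simp [hk]

lemma sum_half_pow_le_one (N : ℕ) : ∑ k ∈ Finset.range N, (1 / 2 : ℝ) ^ (k + 1) ≤ 1 := by
  have h : ∑ k ∈ Finset.range N, (1 / 2 : ℝ) ^ (k + 1) = 1 - (1 / 2) ^ N := by
    induction N with
    | zero => simp
    | succ N ih => rw [Finset.sum_range_succ, ih]; ring
  rw [h]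
  have : (0 : ℝ) < (1 / 2) ^ N := by positivity
  linarith

/-- The `k`-th summand of the rescaled signed kernel. -/
noncomputable def kernelTerm (ψ : ℝ → ℝ) (σ τ : ℝ) (k : ℕ) (t : ℝ) : ℝ :=
  ((-1 : ℝ) ^ k * σ ^ (2 * k) / ((2 : ℝ) ^ k * (k.factorial : ℝ))) *
    (τ⁻¹ ^ (2 * k) * iteratedDeriv (2 * k) (fun t => Real.exp (-ψ t)) t)

lemma abs_kernelTerm_le (hψ : ContDiff ℝ (⊤ : ℕ∞) ψ) (hσ : 0 < σ) (hτ : 0 < τ) (hlam : 0 < lam)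
    (h : 8 * Real.exp 1 * σ * (lam * N) ≤ τ) {k : ℕ} (hk : 1 ≤ k) (hkN : k ≤ N) (t : ℝ) :
    |kernelTerm ψ σ τ k t| ≤ (1 / 2) ^ k * (Real.exp (-ψ t) *
      max (derivSum ψ (2 * N) lam t) (derivSum ψ (2 * N) lam t ^ (2 * k))) := by
  have h1 := abs_iteratedDeriv_exp_neg_le hψ hlam (2 * N) t (2 * k) (by omega) (by omega)
  set X := max (derivSum ψ (2 * N) lam t) (derivSum ψ (2 * N) lam t ^ (2 * k)) with hX
  have hX0 : 0 ≤ X := (derivSum_nonneg ψ (2 * N) hlam t).trans (le_max_left _ _)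
  have hf := Real.exp_pos (-ψ t)
  have hN1 : (1 : ℝ) ≤ N := by exact_mod_cast hk.trans hkN
  have hr : σ * lam * N / τ ≤ 1 / 8 := by
    rw [div_le_div_iff₀ hτ (by norm_num)]
    have he : (1 : ℝ) ≤ Real.exp 1 := Real.one_le_exp zero_le_one
    have : 8 * 1 * (σ * lam * N) ≤ 8 * Real.exp 1 * (σ * lam * N) := by gcongr
    linarith
  have hfac : (2 : ℝ) ^ k * k.factorial * (σ * lam / τ) ^ (2 * k) ≤ (1 / 2) ^ k := by
    have hkf : (k.factorial : ℝ) ≤ (N : ℝ) ^ (2 * k) := by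
      calc (k.factorial : ℝ) ≤ (k : ℝ) ^ k := by exact_mod_cast Nat.factorial_le_pow k
        _ ≤ (N : ℝ) ^ k := by gcongr
        _ ≤ _ := pow_le_pow_right₀ hN1 (by omega)
    calc (2 : ℝ) ^ k * k.factorial * (σ * lam / τ) ^ (2 * k)
        ≤ (2 : ℝ) ^ k * (N : ℝ) ^ (2 * k) * (σ * lam / τ) ^ (2 * k) := by gcongr
      _ = (2 * (σ * lam * N / τ) ^ 2) ^ k := by
          rw [mul_assoc, ← mul_pow, pow_mul, ← mul_pow]; congr 2; ring
      _ ≤ (2 * (1 / 8) ^ 2) ^ k := by gcongr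
      _ ≤ _ := by gcongr; norm_num
  unfold kernelTerm
  rw [abs_mul, abs_div, abs_mul ((-1 : ℝ) ^ k), abs_pow (-1 : ℝ), abs_neg, abs_one, one_pow,
    one_mul, abs_mul (τ⁻¹ ^ (2 * k)),
    abs_of_pos (show 0 < (2 : ℝ) ^ k * (k.factorial : ℝ) by positivity),
    abs_of_pos (show 0 < σ ^ (2 * k) by positivity),
    abs_of_pos (show 0 < τ⁻¹ ^ (2 * k) by positivity)]
  calc _ ≤ σ ^ (2 * k) / ((2 : ℝ) ^ k * (k.factorial : ℝ)) *
        (τ⁻¹ ^ (2 * k) * (((2 : ℝ) ^ k * k.factorial) ^ 2 * lam ^ (2 * k) *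
          Real.exp (-ψ t) * X)) := by
        gcongr
        refine h1.trans ?_
        gcongr
        exact two_mul_factorial_le k
    _ = ((2 : ℝ) ^ k * k.factorial * (σ * lam / τ) ^ (2 * k)) * (Real.exp (-ψ t) * X) := by
        rw [div_pow, mul_pow σ, inv_pow]; field_simp
    _ ≤ _ := by gcongr

lemma measurableSet_ASet (hψ : ContDiff ℝ (⊤ : ℕ∞) ψ) (n : ℕ) (lam : ℝ) :
    MeasurableSet (ASet ψ n lam) :=
  measurableSet_le (continuous_derivSum hψ n lam).measurable measurable_const

lemma Assumption2.integrable_kernelTerm (hψ : Assumption2 ψ Cψ Ct) (k : ℕ) :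
    Integrable (kernelTerm ψ σ τ k) :=
  ((hψ.integrable_iteratedDeriv _).const_mul _).const_mul _

lemma kernelTerm_zero (t : ℝ) : kernelTerm ψ σ τ 0 t = Real.exp (-ψ t) := by
  simp [kernelTerm]

lemma integral_neg_min_kernel_le (hψ : Assumption2 ψ Cψ Ct) (hσ : 0 < σ) (hτ : 0 < τ)
    (hlam : 0 < lam) (h : 8 * Real.exp 1 * σ * (lam * N) ≤ τ) :
    -∫ t, min (∑ k ∈ Finset.range (N + 1), kernelTerm ψ σ τ k t) 0 ≤ ErrPsi ψ (2 * N) lam := by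
  set D := derivSum ψ (2 * N) lam with hDdef
  set A := ASet ψ (2 * N) lam with hAdef
  have hA : MeasurableSet Aᶜ := (measurableSet_ASet hψ.smooth _ _).compl
  have hT : Integrable (fun t => ∑ k ∈ Finset.range (N + 1), kernelTerm ψ σ τ k t) :=
    integrable_finsetSum _ fun k _ => hψ.integrable_kernelTerm k
  have hD0 : ∀ t, 0 ≤ D t := derivSum_nonneg ψ (2 * N) hlam
  have hF : ∀ k ∈ Finset.range N, Integrable (fun t => Real.exp (-ψ t) * D t ^ (2 * (k + 1))) :=
    fun k hk => hψ.integrable_exp_neg_mul_derivSum_pow hlam (by omega)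
      (by have := Finset.mem_range.1 hk; omega)
  have hsum : Integrable (fun t => ∑ k ∈ Finset.range N,
      (1 / 2 : ℝ) ^ (k + 1) * (Real.exp (-ψ t) * D t ^ (2 * (k + 1)))) :=
    integrable_finsetSum _ fun k hk => (hF k hk).const_mul _
  have hpt : ∀ t, -min (∑ k ∈ Finset.range (N + 1), kernelTerm ψ σ τ k t) 0 ≤
      Aᶜ.indicator (fun t => Real.exp (-ψ t) + ∑ k ∈ Finset.range N,
        (1 / 2 : ℝ) ^ (k + 1) * (Real.exp (-ψ t) * D t ^ (2 * (k + 1)))) t := fun t => by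
    have hf := Real.exp_pos (-ψ t)
    have hterm : ∀ k ∈ Finset.range N, |kernelTerm ψ σ τ (k + 1) t| ≤ (1 / 2) ^ (k + 1) *
        (Real.exp (-ψ t) * max (D t) (D t ^ (2 * (k + 1)))) := fun k hk =>
      abs_kernelTerm_le hψ.smooth hσ hτ hlam h (by omega)
        (by have := Finset.mem_range.1 hk; omega) t
    have hR : |∑ k ∈ Finset.range N, kernelTerm ψ σ τ (k + 1) t| ≤ ∑ k ∈ Finset.range N,
        (1 / 2 : ℝ) ^ (k + 1) * (Real.exp (-ψ t) * max (D t) (D t ^ (2 * (k + 1)))) :=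
      (Finset.abs_sum_le_sum_abs _ _).trans (Finset.sum_le_sum hterm)
    have hR' := abs_le.1 hR
    rw [Finset.sum_range_succ', kernelTerm_zero]
    by_cases ht : t ∈ A
    · have hD1 : D t ≤ 1 := ht
      rw [Set.indicator_of_notMem (by simpa using ht)]
      have hle : ∑ k ∈ Finset.range N, (1 / 2 : ℝ) ^ (k + 1) *
          (Real.exp (-ψ t) * max (D t) (D t ^ (2 * (k + 1)))) ≤ Real.exp (-ψ t) := by
        calc _ ≤ ∑ k ∈ Finset.range N, (1 / 2 : ℝ) ^ (k + 1) * (Real.exp (-ψ t) * 1) := by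
              gcongr with k hk
              exact max_le hD1 (pow_le_one₀ (hD0 t) hD1)
          _ = (∑ k ∈ Finset.range N, (1 / 2 : ℝ) ^ (k + 1)) * Real.exp (-ψ t) := by
              rw [Finset.sum_mul]; simp
          _ ≤ 1 * Real.exp (-ψ t) := by gcongr; exact sum_half_pow_le_one N
          _ = _ := one_mul _
      rw [min_eq_right (by linarith [hR'.1])]
      simp
    · have hD1 : 1 ≤ D t := le_of_lt (not_le.1 ht)
      rw [Set.indicator_of_mem (by simpa using ht)]
      have e : ∀ k, max (D t) (D t ^ (2 * (k + 1))) = D t ^ (2 * (k + 1)) := fun k =>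
        max_eq_right (le_self_pow₀ hD1 (by omega))
      simp_rw [e] at hR'
      have hnn : 0 ≤ ∑ k ∈ Finset.range N, (1 / 2 : ℝ) ^ (k + 1) *
          (Real.exp (-ψ t) * D t ^ (2 * (k + 1))) :=
        Finset.sum_nonneg fun k _ => by have := hD0 t; positivity
      rw [neg_le]
      exact le_min (by linarith [hR'.1]) (by linarith)
  rw [← integral_neg]
  calc _ ≤ ∫ t, Aᶜ.indicator (fun t => Real.exp (-ψ t) + ∑ k ∈ Finset.range N,
        (1 / 2 : ℝ) ^ (k + 1) * (Real.exp (-ψ t) * D t ^ (2 * (k + 1)))) t :=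
        integral_mono (hT.inf (integrable_zero _ _ _)).neg
          ((hψ.integrable_exp_neg.add hsum).indicator hA) hpt
    _ = (∫ t in Aᶜ, Real.exp (-ψ t)) + ∑ k ∈ Finset.range N, (1 / 2 : ℝ) ^ (k + 1) *
        ∫ t in Aᶜ, Real.exp (-ψ t) * D t ^ (2 * (k + 1)) := by
        rw [integral_indicator hA, integral_add hψ.integrable_exp_neg.integrableOn
          hsum.integrableOn, integral_finsetSum _ fun k hk =>
          ((hF k hk).const_mul _).integrableOn]
        simp_rw [integral_const_mul]
    _ ≤ (∫ t in Aᶜ, Real.exp (-ψ t)) + ∑ k ∈ Finset.range N, (1 / 2 : ℝ) ^ (k + 1) *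
        ⨆ k ∈ Finset.Icc 1 (2 * N), ∫ t in Aᶜ, Real.exp (-ψ t) * D t ^ k := by
        gcongr with k hk
        have hk' := Finset.mem_range.1 hk
        refine le_iSup_mem_Icc (F := fun k => ∫ t in Aᶜ, Real.exp (-ψ t) * D t ^ k)
          (fun k => integral_nonneg fun t => ?_) (Finset.mem_Icc.2 ⟨by omega, by omega⟩)
        have := hD0 t
        positivity
    _ ≤ _ := by
        rw [← Finset.sum_mul]
        have hS : 0 ≤ ⨆ k ∈ Finset.Icc 1 (2 * N), ∫ t in Aᶜ, Real.exp (-ψ t) * D t ^ k :=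
          Real.iSup_nonneg fun k => Real.iSup_nonneg fun _ => integral_nonneg fun t => by
            have := hD0 t
            positivity
        have := mul_le_of_le_one_left hS (sum_half_pow_le_one N)
        unfold ErrPsi
        linarith

lemma ErrPsi_nonneg (ψ : ℝ → ℝ) (n : ℕ) (hlam : 0 < lam) : 0 ≤ ErrPsi ψ n lam := by
  refine add_nonneg (integral_nonneg fun t => (Real.exp_pos _).le)
    (Real.iSup_nonneg fun k => Real.iSup_nonneg fun _ => integral_nonneg fun t => ?_)
  have := derivSum_nonneg ψ n hlam t
  positivity

lemma signedKernel_locDensity_eq_kernelTerm (hψ : ContDiff ℝ (⊤ : ℕ∞) ψ) (y x : ℝ) :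
    signedKernel σ (locDensity ψ τ) N y x
      = τ⁻¹ * ∑ k ∈ Finset.range (N + 1), kernelTerm ψ σ τ k ((y - x) / τ) := by
  rw [signedKernel_locDensity hψ, Finset.mul_sum]
  refine Finset.sum_congr rfl fun k _ => ?_
  simp only [scaledDeriv, kernelTerm]
  ring

lemma integral_comp_sub_div (hτ : 0 < τ) (F : ℝ → ℝ) (x : ℝ) :
    ∫ y, τ⁻¹ * F ((y - x) / τ) = ∫ t, F t := by
  rw [integral_const_mul, integral_sub_right_eq_self (fun y => F (y / τ)) x,
    Measure.integral_comp_div F τ, smul_eq_mul, abs_of_pos hτ]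
  field_simp

lemma integral_sum_kernelTerm (hψ : Assumption2 ψ Cψ Ct) :
    ∫ t, ∑ k ∈ Finset.range (N + 1), kernelTerm ψ σ τ k t = 1 := by
  rw [integral_finsetSum _ fun k _ => hψ.integrable_kernelTerm k, Finset.sum_range_succ',
    Finset.sum_eq_zero fun k _ => ?_]
  · simp_rw [kernelTerm_zero]
    rw [hψ.norm_one, zero_add]
  · simp only [kernelTerm]
    rw [integral_const_mul, integral_const_mul,
      integral_eq_zero_of_hasDerivAt_of_integrable
        (f := iteratedDeriv (2 * k + 1) (fun t => Real.exp (-ψ t))) (fun t => ?_)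
        (hψ.integrable_iteratedDeriv _) (hψ.integrable_iteratedDeriv _)]
    · simp
    · exact hasDerivAt_iteratedDeriv_exp_neg hψ.smooth (2 * k + 1) t

/-- The normalization discrepancy bound for the location target. -/
lemma integral_pFun_qFun_le (hψ : Assumption2 ψ Cψ Ct) (hσ : 0 < σ) (hτ : 0 < τ)
    (hlam : 0 < lam) (h : 8 * Real.exp 1 * σ * (lam * N) ≤ τ) (θ : ℝ) :
    (1 / 2) * ∫ x : ℝ, (|pFun σ (locDensity ψ τ) N x - 1| + qFun σ (locDensity ψ τ) N x)
      * srcDensity σ θ x ≤ ErrPsi ψ (2 * N) lam := by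
  set T : ℝ → ℝ := fun t => ∑ k ∈ Finset.range (N + 1), kernelTerm ψ σ τ k t with hTdef
  have hT : Integrable T := integrable_finsetSum _ fun k _ => hψ.integrable_kernelTerm k
  have hτi : 0 ≤ τ⁻¹ := by positivity
  have hp : ∀ x, pFun σ (locDensity ψ τ) N x = ∫ t, max (T t) 0 := fun x => by
    rw [pFun, ← integral_comp_sub_div hτ (fun t => max (T t) 0) x]
    congr 1; ext y
    rw [signedKernel_locDensity_eq_kernelTerm hψ.smooth, mul_max_of_nonneg _ _ hτi, mul_zero]
  have hq : ∀ x, qFun σ (locDensity ψ τ) N x = -∫ t, min (T t) 0 := fun x => by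
    rw [qFun, ← integral_comp_sub_div hτ (fun t => min (T t) 0) x]
    congr 2; ext y
    rw [signedKernel_locDensity_eq_kernelTerm hψ.smooth, mul_min_of_nonneg _ _ hτi, mul_zero]
  have hpq : (∫ t, max (T t) 0) + ∫ t, min (T t) 0 = 1 := by
    have hmax : Integrable (fun t => max (T t) 0) := hT.sup (integrable_zero _ _ _)
    have hmin : Integrable (fun t => min (T t) 0) := hT.inf (integrable_zero _ _ _)
    rw [← integral_add hmax hmin,
      ← integral_sum_kernelTerm (σ := σ) (τ := τ) (N := N) hψ]
    congr 1; ext t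
    simp [max_add_min, hTdef]
  have hq0 : 0 ≤ -∫ t, min (T t) 0 := by
    rw [← integral_neg]
    exact integral_nonneg fun t => by simp
  have hle := integral_neg_min_kernel_le hψ hσ hτ hlam h
  simp_rw [hp, hq]
  rw [integral_const_mul, integral_srcDensity hσ, mul_one,
    abs_of_nonneg (by linarith)]
  linarith

end Normalization

section Numerics

lemma half_pow_mul_factorial_le {N j : ℕ} (hj : 1 ≤ j) (hjN : j ≤ N + 1) (h : 2 * j ≤ N + 3) :
    (((N : ℝ) + 1) / 2) ^ (j - 1) * ((N + 1 - j).factorial : ℝ) ≤ N.factorial := by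
  obtain ⟨i, rfl⟩ : ∃ i, j = i + 1 := ⟨j - 1, by omega⟩
  have h1 := Nat.factorial_mul_descFactorial (show i ≤ N by omega)
  have h2 : ((N : ℝ) + 1) / 2 ≤ ((N + 1 - i : ℕ) : ℝ) := by
    rw [div_le_iff₀ (by norm_num)]
    exact_mod_cast (show N + 1 ≤ (N + 1 - i) * 2 by omega)
  rw [Nat.add_sub_cancel, Nat.add_sub_add_right, ← h1, Nat.cast_mul, mul_comm]
  gcongr
  calc (((N : ℝ) + 1) / 2) ^ i ≤ ((N + 1 - i : ℕ) : ℝ) ^ i := by gcongr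
    _ ≤ _ := by exact_mod_cast Nat.pow_sub_le_descFactorial N i

lemma pow_mul_exp_le_CbarPsi_mul_exp (Cψ : ℕ) {L : ℝ} (hL : 0 ≤ L) :
    L ^ (2 * (1 + Cψ)) * Real.exp 1 ^ (2 * (1 + Cψ))
      ≤ CbarPsi Cψ * Real.exp ((2 * Real.exp 1)⁻¹ * L) := by
  set D := 1 + Cψ with hD
  have he : (1 : ℝ) ≤ Real.exp 1 := Real.one_le_exp zero_le_one
  have hx := Real.pow_div_factorial_le_exp ((2 * Real.exp 1)⁻¹ * L) (by positivity) (2 * D)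
  have hf : ((2 * D).factorial : ℝ) ≤ Real.exp 1 ^ (4 * D ^ 2) := by
    calc ((2 * D).factorial : ℝ) ≤ ((2 * D : ℕ) : ℝ) ^ (2 * D) := by
          exact_mod_cast Nat.factorial_le_pow (2 * D)
      _ ≤ (Real.exp 1 ^ (2 * D)) ^ (2 * D) := by
          gcongr
          rw [← Real.exp_nat_mul, mul_one]
          linarith [Real.add_one_le_exp ((2 * D : ℕ) : ℝ)]
      _ = _ := by rw [← pow_mul]; congr 1; ring
  have hpi : (1 : ℝ) ≤ 16 * Real.pi ^ 2 := by nlinarith [Real.pi_gt_three]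
  have hE := Real.exp_pos ((2 * Real.exp 1)⁻¹ * L)
  calc L ^ (2 * D) * Real.exp 1 ^ (2 * D)
      = (2 * Real.exp 1) ^ (2 * D) * Real.exp 1 ^ (2 * D) * (2 * D).factorial *
        (((2 * Real.exp 1)⁻¹ * L) ^ (2 * D) / (2 * D).factorial) := by
        rw [mul_pow _ L, inv_pow]
        field_simp
    _ ≤ (2 * Real.exp 1) ^ (2 * D) * (2 * Real.exp 1) ^ (2 * D) * Real.exp 1 ^ (4 * D ^ 2) *
        Real.exp ((2 * Real.exp 1)⁻¹ * L) := by
        gcongr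
        linarith
    _ = 1 * ((2 * Real.exp 1) ^ (4 * D) * Real.exp 1 ^ (4 * D ^ 2) *
        Real.exp ((2 * Real.exp 1)⁻¹ * L)) := by ring
    _ ≤ (16 * Real.pi ^ 2) * ((2 * Real.exp 1) ^ (4 * D) * Real.exp 1 ^ (4 * D ^ 2) *
        Real.exp ((2 * Real.exp 1)⁻¹ * L)) := by gcongr
    _ = _ := by unfold CbarPsi; ring

lemma two_mul_exp_mul_le_of_CbarPsi_le {Cψ : ℕ} {L : ℝ} (hL : 0 ≤ L)
    (h : CbarPsi Cψ ≤ L ^ (2 * (1 + Cψ))) :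
    2 * Real.exp 1 * ((1 + Cψ : ℕ) : ℝ) ≤ L := by
  set D := 1 + Cψ with hD
  have he : (1 : ℝ) ≤ Real.exp 1 := Real.one_le_exp zero_le_one
  have hpi : (1 : ℝ) ≤ 16 * Real.pi ^ 2 := by nlinarith [Real.pi_gt_three]
  have h1 : ((2 * Real.exp 1) ^ 2 * Real.exp 1 ^ (2 * D)) ^ (2 * D) ≤ L ^ (2 * D) := by
    refine le_trans ?_ h
    calc ((2 * Real.exp 1) ^ 2 * Real.exp 1 ^ (2 * D)) ^ (2 * D)
        = 1 * ((2 * Real.exp 1) ^ (4 * D) * Real.exp 1 ^ (4 * D ^ 2)) := by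
          generalize 2 * Real.exp 1 = a
          ring
      _ ≤ (16 * Real.pi ^ 2) * ((2 * Real.exp 1) ^ (4 * D) * Real.exp 1 ^ (4 * D ^ 2)) := by
          gcongr
      _ = _ := by unfold CbarPsi; ring
  refine le_trans ?_ ((pow_le_pow_iff_left₀ (by positivity) hL (by omega)).1 h1)
  have hD1 : (D : ℝ) ≤ Real.exp 1 ^ (2 * D) := by
    rw [← Real.exp_nat_mul, mul_one]
    push_cast
    linarith [Real.add_one_le_exp (2 * (D : ℝ)), Nat.cast_nonneg (α := ℝ) D]
  gcongr
  exact le_self_pow₀ (by linarith) (by norm_num)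

/-- The choice of truncation order that turns the factorial bound into an exponential one. -/
lemma truncation_bound_le {Cψ N j : ℕ} {L σ τ Ct : ℝ} (hσ : 0 < σ) (hτ : 0 < τ) (hCt : 0 < Ct)
    (hr : 8 * Real.exp 1 * σ * Ct ≤ τ) (hL : 0 < L)
    (hLN : L ^ (2 * (1 + Cψ)) = 2 * (N : ℝ) + 1) (hj : 1 ≤ j) (hjN : j ≤ N + 1)
    (hjN' : 2 * j ≤ N + 3) (hjL : 2 * Real.exp 1 * ((1 + Cψ : ℕ) : ℝ) * j ≤ L)
    (hLj : L ≤ 2 * Real.exp 1 * ((1 + Cψ : ℕ) : ℝ) * (j + 1)) :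
    (1 / 2) * (((N + 1 - j).factorial : ℝ) / N.factorial * (σ ^ 2 / 2) ^ j / j *
      (τ⁻¹ ^ (2 * j) * (2 * ((2 * j).factorial * Ct ^ (2 * j) * (Cψ * (2 * j)).factorial))))
      ≤ CbarPsi Cψ * Real.exp (-((2 * Real.exp 1)⁻¹ * L)) := by
  set D := 1 + Cψ with hD
  have he : (1 : ℝ) ≤ Real.exp 1 := Real.one_le_exp zero_le_one
  have hN0 : (0 : ℝ) ≤ N := Nat.cast_nonneg N
  have hj1 : (1 : ℝ) ≤ j := by exact_mod_cast hj
  have hfac : ((N + 1 - j).factorial : ℝ) / N.factorial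
      ≤ ((N : ℝ) + 1) / 2 * (2 / ((N : ℝ) + 1)) ^ j := by
    rw [div_le_iff₀ (by positivity)]
    calc ((N + 1 - j).factorial : ℝ)
        = (2 / ((N : ℝ) + 1)) ^ (j - 1) * ((((N : ℝ) + 1) / 2) ^ (j - 1) *
          ((N + 1 - j).factorial : ℝ)) := by
          rw [← mul_assoc, ← mul_pow, show 2 / ((N : ℝ) + 1) * (((N : ℝ) + 1) / 2) = 1 by
            field_simp, one_pow, one_mul]
      _ ≤ (2 / ((N : ℝ) + 1)) ^ (j - 1) * N.factorial := by
          gcongr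
          exact half_pow_mul_factorial_le hj hjN hjN'
      _ = _ := by
          obtain ⟨i, rfl⟩ : ∃ i, j = i + 1 := ⟨j - 1, by omega⟩
          rw [Nat.add_sub_cancel, pow_succ]
          field_simp
  have hprod : ((2 * j).factorial : ℝ) * (Cψ * (2 * j)).factorial ≤
      (L / Real.exp 1) ^ (2 * D * j) := by
    calc ((2 * j).factorial : ℝ) * (Cψ * (2 * j)).factorial
        ≤ ((2 * D * j : ℕ) : ℝ) ^ (2 * D * j) := by
          have h1 := Nat.le_of_dvd (Nat.factorial_pos _)
            (Nat.factorial_mul_factorial_dvd_factorial_add (2 * j) (Cψ * (2 * j)))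
          rw [show 2 * j + Cψ * (2 * j) = 2 * D * j by rw [hD]; ring] at h1
          exact_mod_cast h1.trans (Nat.factorial_le_pow _)
      _ ≤ _ := by
          gcongr
          rw [le_div_iff₀ (by positivity)]
          push_cast at hjL ⊢
          linarith
  have hratio : (σ * Ct / τ) ^ (2 * j) ≤ (1 / 2) ^ j := by
    have h1 : σ * Ct / τ ≤ 1 / 8 := by
      rw [div_le_div_iff₀ hτ (by norm_num)]
      have : 8 * 1 * (σ * Ct) ≤ 8 * Real.exp 1 * (σ * Ct) := by gcongr
      linarith
    rw [pow_mul]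
    calc ((σ * Ct / τ) ^ 2) ^ j ≤ ((1 / 8) ^ 2) ^ j := by gcongr
      _ ≤ _ := by gcongr; norm_num
  have hinv : (1 / ((N : ℝ) + 1)) ≤ 2 / L ^ (2 * D) := by
    rw [hLN, div_le_div_iff₀ (by positivity) (by positivity)]
    linarith
  have hexp : (Real.exp 1)⁻¹ ^ (2 * D * j)
      ≤ Real.exp 1 ^ (2 * D) * Real.exp (-(2 * ((2 * Real.exp 1)⁻¹ * L))) := by
    rw [← Real.exp_neg, ← Real.exp_nat_mul, ← Real.exp_nat_mul, ← Real.exp_add]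
    apply Real.exp_le_exp.2
    have : 2 * ((2 * Real.exp 1)⁻¹ * L) ≤ 2 * D * (j + 1) := by
      rw [show 2 * ((2 * Real.exp 1)⁻¹ * L) = L / Real.exp 1 by field_simp,
        div_le_iff₀ (by positivity)]
      linarith
    push_cast
    linarith
  calc _ ≤ (1 / 2) * (((N : ℝ) + 1) / 2 * (2 / ((N : ℝ) + 1)) ^ j * (σ ^ 2 / 2) ^ j / 1 *
      (τ⁻¹ ^ (2 * j) * (2 * ((2 * j).factorial * Ct ^ (2 * j) * (Cψ * (2 * j)).factorial)))) := by
        gcongr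
    _ = (((N : ℝ) + 1) / 2) * (σ * Ct / τ) ^ (2 * j) * (1 / ((N : ℝ) + 1)) ^ j *
      ((2 * j).factorial * (Cψ * (2 * j)).factorial) := by
        rw [div_pow (σ * Ct), mul_pow σ, pow_mul σ, div_pow, div_pow, div_pow, inv_pow, one_pow]
        field_simp
    _ ≤ L ^ (2 * D) * (1 / 2) ^ j * (2 / L ^ (2 * D)) ^ j *
      (L / Real.exp 1) ^ (2 * D * j) := by
        gcongr
        rw [hLN]
        linarith
    _ = L ^ (2 * D) * (Real.exp 1)⁻¹ ^ (2 * D * j) := by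
        rw [div_pow L, pow_mul L (2 * D) j, inv_pow, div_pow 2, div_pow 1, one_pow]
        field_simp
    _ ≤ L ^ (2 * D) *
        (Real.exp 1 ^ (2 * D) * Real.exp (-(2 * ((2 * Real.exp 1)⁻¹ * L)))) := by gcongr
    _ = L ^ (2 * D) * Real.exp 1 ^ (2 * D) * Real.exp (-(2 * ((2 * Real.exp 1)⁻¹ * L))) := by ring
    _ ≤ CbarPsi Cψ * Real.exp ((2 * Real.exp 1)⁻¹ * L) *
        Real.exp (-(2 * ((2 * Real.exp 1)⁻¹ * L))) :=
        mul_le_mul_of_nonneg_right (pow_mul_exp_le_CbarPsi_mul_exp Cψ hL.le) (Real.exp_pos _).le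
    _ = _ := by
        rw [mul_assoc, ← Real.exp_add]
        congr 2
        ring

end Numerics

/-- The deficiency bound for the signed kernel of the location target. -/
lemma integral_abs_signedKernel_sub_le {ψ : ℝ → ℝ} {Cψ : ℕ} {Ct σ τ : ℝ} {N : ℕ}
    (hψ : Assumption2 ψ Cψ Ct) (hN : CbarPsi Cψ ≤ 2 * (N : ℝ) + 1) (hσ : 0 < σ) (hτ : 0 < τ)
    (h : 8 * Real.exp 1 * σ * Ct ≤ τ) (θ : ℝ) :
    (1 / 2) * ∫ y : ℝ, |(∫ x : ℝ, signedKernel σ (locDensity ψ τ) N y x * srcDensity σ θ x)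
        - locDensity ψ τ y θ|
      ≤ CbarPsi Cψ * Real.exp (-((2 * Real.exp 1)⁻¹ *
          (2 * (N : ℝ) + 1) ^ ((1 : ℝ) / (2 * (1 + (Cψ : ℝ)))))) := by
  set L := (2 * (N : ℝ) + 1) ^ ((1 : ℝ) / (2 * (1 + (Cψ : ℝ)))) with hLdef
  have hL : 0 < L := by positivity
  have hLN : L ^ (2 * (1 + Cψ)) = 2 * (N : ℝ) + 1 := by
    rw [hLdef, ← Real.rpow_natCast, ← Real.rpow_mul (by positivity)]
    push_cast
    rw [one_div_mul_cancel (by positivity), Real.rpow_one]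
  have hDL := two_mul_exp_mul_le_of_CbarPsi_le hL.le (hLN ▸ hN)
  have he : (1 : ℝ) ≤ Real.exp 1 := Real.one_le_exp zero_le_one
  have hD1 : (1 : ℝ) ≤ ((1 + Cψ : ℕ) : ℝ) := by exact_mod_cast Nat.le_add_right 1 Cψ
  set c := 2 * Real.exp 1 * ((1 + Cψ : ℕ) : ℝ) with hc
  have hc2 : 2 ≤ c := by
    calc (2 : ℝ) = 2 * 1 * 1 := by norm_num
      _ ≤ c := by rw [hc]; gcongr
  have hc0 : 0 < c := by linarith
  set j := ⌊L / c⌋₊ with hjdef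
  have hj : 1 ≤ j := Nat.le_floor (by rw [Nat.cast_one, le_div_iff₀ hc0]; linarith)
  have hjL : c * j ≤ L := by
    have := Nat.floor_le (show 0 ≤ L / c by positivity)
    rwa [le_div_iff₀ hc0, mul_comm] at this
  have hLj : L ≤ c * (j + 1) := by
    have := (Nat.lt_floor_add_one (L / c)).le
    rwa [div_le_iff₀ hc0, mul_comm] at this
  have hL1 : 1 ≤ L := by linarith
  have hLle : L ≤ (N : ℝ) + 1 := by
    have h2 : L ^ 2 ≤ 2 * (N : ℝ) + 1 := hLN ▸ pow_le_pow_right₀ hL1 (by omega)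
    exact abs_le_of_sq_le_sq' (by nlinarith [sq_nonneg (N : ℝ)]) (by positivity) |>.2
  have hjN : 2 * j ≤ N + 1 := by
    have : 2 * (j : ℝ) ≤ N + 1 := by
      have : 2 * (j : ℝ) ≤ c * j := by gcongr
      linarith
    exact_mod_cast this
  have hint : ∀ y k, Integrable (fun x => scaledDeriv ψ τ (2 * k) (y - x) * srcDensity σ θ x) :=
    fun y k => by
      refine ((hψ.integrable_scaledDeriv hτ (2 * k)).comp_sub_left y).mul_bdd
        (c := 1 / (Real.sqrt (2 * Real.pi) * σ))
        (continuous_srcDensity σ θ).aestronglyMeasurable (Eventually.of_forall fun x => ?_)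
      rw [Real.norm_eq_abs, abs_of_nonneg (srcDensity_nonneg hσ θ x), srcDensity]
      refine mul_le_of_le_one_right (by positivity) (Real.exp_le_one_iff.2 ?_)
      exact div_nonpos_of_nonpos_of_nonneg (neg_nonpos.2 (sq_nonneg _)) (by positivity)
  have hker : ∀ y, (∫ x : ℝ, signedKernel σ (locDensity ψ τ) N y x * srcDensity σ θ x)
      = ∑ k ∈ Finset.range (N + 1),
        ((-1 : ℝ) ^ k * σ ^ (2 * k) / ((2 : ℝ) ^ k * (k.factorial : ℝ))) *
          ∫ x, scaledDeriv ψ τ (2 * k) (y - x) * srcDensity σ θ x := fun y => by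
    simp_rw [signedKernel_locDensity hψ.smooth, Finset.sum_mul, mul_assoc]
    rw [integral_finsetSum _ fun k _ => (hint y k).const_mul _]
    simp_rw [integral_const_mul]
  simp_rw [hker, locDensity_eq]
  refine le_trans ?_ (truncation_bound_le hσ hτ hψ.Ct_pos h hL hLN hj (by omega) (by omega)
    hjL hLj)
  have hb := integral_abs_truncated_sub_le (hasDerivAt_scaledDeriv hψ.smooth τ)
    (hψ.integrable_scaledDeriv hτ) hσ θ hj (show j ≤ N + 1 by omega)
  refine mul_le_mul_of_nonneg_left (hb.trans ?_) (by norm_num)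
  rw [integral_abs_scaledDeriv hτ]
  gcongr
  exact hψ.integral_abs_iteratedDeriv_le (by omega)

/-- Lemma 2: (a) signed-kernel deficiency bound and
(b) normalization discrepancy bound, for the location target. -/
theorem location_signed_and_pq_bounds
    (σ τ lam : ℝ) (ψ : ℝ → ℝ) (Cψ : ℕ) (Ct : ℝ) (N : ℕ)
    (hψ : Assumption2 ψ Cψ Ct)
    (hN : CbarPsi Cψ ≤ 2 * (N:ℝ) + 1)
    (hτ : 8 * Real.exp 1 * σ * max Ct (lam * (N:ℝ)) ≤ τ)
    (hσ : 0 < σ) (hlam : 0 < lam) :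
    (∀ θ : ℝ,
      (1/2) * ∫ y : ℝ,
          |(∫ x : ℝ, signedKernel σ (locDensity ψ τ) N y x * srcDensity σ θ x)
            - locDensity ψ τ y θ|
        ≤ CbarPsi Cψ *
            Real.exp (-((2 * Real.exp 1)⁻¹ *
              (2*(N:ℝ)+1) ^ ((1:ℝ)/(2*(1+(Cψ:ℝ))))))) ∧
    (∀ θ : ℝ,
      (1/2) * ∫ x : ℝ,
          (|pFun σ (locDensity ψ τ) N x - 1| + qFun σ (locDensity ψ τ) N x)
            * srcDensity σ θ x
        ≤ 4 * ErrPsi ψ (2*N) lam) := by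
  have hCt := hψ.Ct_pos
  have hpos : 0 < 8 * Real.exp 1 * σ := by positivity
  have h1 : 8 * Real.exp 1 * σ * Ct ≤ τ :=
    (mul_le_mul_of_nonneg_left (le_max_left _ _) hpos.le).trans hτ
  have h2 : 8 * Real.exp 1 * σ * (lam * (N:ℝ)) ≤ τ :=
    (mul_le_mul_of_nonneg_left (le_max_right _ _) hpos.le).trans hτ
  have hτ0 : 0 < τ := (mul_pos hpos hCt).trans_le h1
  refine ⟨fun θ => integral_abs_signedKernel_sub_le hψ hN hσ hτ0 h1 θ, fun θ => ?_⟩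
  have h3 := integral_pFun_qFun_le hψ hσ hτ0 hlam h2 θ
  have h4 := ErrPsi_nonneg ψ (2 * N) hlam
  linarith
end

section
/- Let ν ≥ 1 be a real number and let ψ_ν(t) = ((ν+1)/2)·log(1 + t²/ν), the negative log-density of the Student's t distribution with ν degrees of freedom up to an additive constant. Then: (i) for every integer n ≥ 1 and every x ∈ ℝ, |ψ_ν^{(n)}(x)| ≤ ((ν+1)/2)·n!·(3e)^n; (ii) consequently, for every integer n ≥ 1 and every x ∈ ℝ, Σ_{j=1}^{n} |ψ_ν^{(j)}(x)|/((6e(ν+1))^j·j!) ≤ 1, so that ψ_ν ∈ F(6e(ν+1)); and (iii) exp(−ψ_ν(t) + ψ_ν(t/2)) ≤ 1 for every t ∈ ℝ. -/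
open MeasureTheory Real Filter

/-- The class `F(R)` of globally analytic functions: `g` is smooth and all partial
sums `Σ_{j=1}^{n} |g^{(j)}(x)|/(R^j·j!)` are at most 1. -/
def memF (R : ℝ) (g : ℝ → ℝ) : Prop :=
  ContDiff ℝ (⊤ : ℕ∞) g ∧
    ∀ (x : ℝ) (n : ℕ),
      ∑ j ∈ Finset.Icc 1 n, |iteratedDeriv j g x| / (R^j * (Nat.factorial j : ℝ)) ≤ 1

/-- The `(n+1)`-st derivative of the Student's-t negative log-density is the real part of a
multiple of `(x + i√ν)^{-(n+1)}`. -/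
lemma iteratedDeriv_succ_student_t {ν : ℝ} (hν : 0 < ν) (n : ℕ) :
    iteratedDeriv (n + 1) (fun t : ℝ => ((ν+1)/2) * Real.log (1 + t^2/ν)) =
      fun x : ℝ => (ν + 1) *
        ((-1 : ℂ) ^ n * (n.factorial : ℂ) * (((x : ℂ) + √ν * Complex.I) ^ (n + 1))⁻¹).re := by
  have hs : 0 < √ν := Real.sqrt_pos.2 hν
  have hss : √ν * √ν = ν := Real.mul_self_sqrt hν.le
  induction n with
  | zero =>
    funext x
    have hpos : 0 < 1 + x ^ 2 / ν := by positivity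
    have hd : HasDerivAt (fun t : ℝ => ((ν+1)/2) * Real.log (1 + t^2/ν))
        (((ν+1)/2) * ((2 * x / ν) / (1 + x^2/ν))) x := by
      refine HasDerivAt.const_mul _ (HasDerivAt.log ?_ hpos.ne')
      simpa using (((hasDerivAt_id x).pow 2).div_const ν).const_add 1
    rw [zero_add, iteratedDeriv_one, hd.deriv]
    have hx : x ^ 2 + ν ≠ 0 := by positivity
    simp only [pow_zero, Nat.factorial_zero, Nat.cast_one, one_mul, pow_one, Complex.inv_re,
      Complex.normSq_apply, Complex.add_re, Complex.add_im, Complex.ofReal_re, Complex.ofReal_im,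
      Complex.re_ofReal_mul, Complex.im_ofReal_mul, Complex.I_re, Complex.I_im, mul_zero, add_zero,
      zero_add, mul_one, hss]
    have hx2 : x * x + ν ≠ 0 := by rwa [← sq]
    field_simp
    ring
  | succ n ih =>
    rw [iteratedDeriv_succ, ih]
    funext x
    refine HasDerivAt.deriv (HasDerivAt.const_mul _ ?_)
    have hz : (x : ℂ) + √ν * Complex.I ≠ 0 := fun h => hs.ne' <| by
      simpa using congrArg Complex.im h
    refine HasDerivAt.real_of_complex (e := fun z : ℂ =>
      (-1 : ℂ) ^ n * (n.factorial : ℂ) * ((z + √ν * Complex.I) ^ (n + 1))⁻¹) ?_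
    have h := (((((hasDerivAt_id (x : ℂ)).add_const (√ν * Complex.I)).pow (n + 1)).inv
      (pow_ne_zero _ hz))).const_mul ((-1 : ℂ) ^ n * (n.factorial : ℂ))
    refine h.congr_deriv ?_
    simp only [id, Pi.pow_apply, Nat.factorial_succ]
    push_cast
    field_simp
    ring

lemma abs_iteratedDeriv_student_t_le {ν : ℝ} (hν : 1 ≤ ν) {n : ℕ} (hn : 1 ≤ n) (x : ℝ) :
    |iteratedDeriv n (fun t : ℝ => ((ν+1)/2) * Real.log (1 + t^2/ν)) x|
      ≤ ((ν+1)/2) * (n.factorial : ℝ) * (3 * Real.exp 1)^n := by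
  obtain ⟨n, rfl⟩ := Nat.exists_eq_add_of_le' hn
  rw [iteratedDeriv_succ_student_t (by linarith)]
  have hs : 1 ≤ √ν := Real.one_le_sqrt.2 hν
  have hz : 1 ≤ ‖(x : ℂ) + √ν * Complex.I‖ := by
    refine hs.trans ((le_abs_self _).trans ?_)
    simpa using Complex.abs_im_le_norm ((x : ℂ) + √ν * Complex.I)
  have hre : |((-1 : ℂ) ^ n * (n.factorial : ℂ) *
      (((x : ℂ) + √ν * Complex.I) ^ (n + 1))⁻¹).re| ≤ n.factorial := by
    refine (Complex.abs_re_le_norm _).trans ?_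
    rw [norm_mul, norm_mul, norm_inv, norm_pow, norm_pow, norm_neg, norm_one, one_pow, one_mul,
      Complex.norm_natCast]
    exact mul_le_of_le_one_right (by positivity) (inv_le_one_of_one_le₀ (one_le_pow₀ hz))
  have he : 1 ≤ Real.exp 1 := Real.one_le_exp zero_le_one
  have hpow : 2 ≤ (3 * Real.exp 1) ^ (n + 1) :=
    (by linarith : 2 ≤ 3 * Real.exp 1).trans (le_self_pow₀ (by linarith) (by omega))
  have hfac : (n.factorial : ℝ) ≤ ((n + 1).factorial : ℝ) :=
    Nat.cast_le.2 (Nat.factorial_le n.le_succ)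
  calc |(ν + 1) * ((-1 : ℂ) ^ n * (n.factorial : ℂ) *
          (((x : ℂ) + √ν * Complex.I) ^ (n + 1))⁻¹).re|
      ≤ (ν + 1) * n.factorial := by
        rw [abs_mul, abs_of_pos (by linarith)]
        gcongr
    _ ≤ (ν + 1) * (n + 1).factorial := by gcongr
    _ = ((ν + 1) / 2) * (n + 1).factorial * 2 := by ring
    _ ≤ _ := by gcongr

lemma sum_Icc_one_half_pow_le_one (n : ℕ) : ∑ j ∈ Finset.Icc 1 n, (1 / 2 : ℝ) ^ j ≤ 1 := by
  suffices h : ∑ j ∈ Finset.Icc 1 n, (1 / 2 : ℝ) ^ j = 1 - (1 / 2) ^ n by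
    rw [h]
    linarith [pow_pos (one_half_pos (α := ℝ)) n]
  induction n with
  | zero => simp
  | succ n ih =>
    rw [Finset.sum_Icc_succ_top (by omega), ih]
    ring

lemma sum_abs_iteratedDeriv_student_t_le {ν : ℝ} (hν : 1 ≤ ν) (n : ℕ) (x : ℝ) :
    ∑ j ∈ Finset.Icc 1 n,
      |iteratedDeriv j (fun t : ℝ => ((ν+1)/2) * Real.log (1 + t^2/ν)) x| /
        ((6 * Real.exp 1 * (ν+1))^j * (Nat.factorial j : ℝ)) ≤ 1 := by
  refine (Finset.sum_le_sum fun j hj => ?_).trans (sum_Icc_one_half_pow_le_one n)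
  have hj1 : 1 ≤ j := (Finset.mem_Icc.1 hj).1
  have hν0 : 0 < ν + 1 := by linarith
  rw [div_le_iff₀ (by positivity)]
  refine (abs_iteratedDeriv_student_t_le hν hj1 x).trans ?_
  have hpow : ν + 1 ≤ (ν + 1) ^ j := le_self_pow₀ (by linarith) (by omega)
  have hsplit : (1 / 2 : ℝ) ^ j * (6 * Real.exp 1 * (ν + 1)) ^ j =
      (3 * Real.exp 1) ^ j * (ν + 1) ^ j := by
    rw [← mul_pow, ← mul_pow]
    ring
  calc (ν + 1) / 2 * j.factorial * (3 * Real.exp 1) ^ j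
      ≤ (ν + 1) ^ j * j.factorial * (3 * Real.exp 1) ^ j := by
        gcongr
        linarith
    _ = (1 / 2) ^ j * ((6 * Real.exp 1 * (ν + 1)) ^ j * j.factorial) := by
        rw [← mul_assoc, hsplit]
        ring

/-- the Student's-t negative log-density
`ψ_ν(t) = ((ν+1)/2)·log(1 + t²/ν)` has derivatives bounded by
`((ν+1)/2)·n!·(3e)^n`, belongs to `F(6e(ν+1))`, and satisfies
`exp(−ψ_ν(t) + ψ_ν(t/2)) ≤ 1`. -/
theorem student_t_log_density
    (ν : ℝ) (hν : 1 ≤ ν) :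
    (∀ n : ℕ, 1 ≤ n → ∀ x : ℝ,
      |iteratedDeriv n (fun t : ℝ => ((ν+1)/2) * Real.log (1 + t^2/ν)) x|
        ≤ ((ν+1)/2) * (Nat.factorial n : ℝ) * (3 * Real.exp 1)^n) ∧
    (∀ n : ℕ, 1 ≤ n → ∀ x : ℝ,
      ∑ j ∈ Finset.Icc 1 n,
          |iteratedDeriv j (fun t : ℝ => ((ν+1)/2) * Real.log (1 + t^2/ν)) x| /
            ((6 * Real.exp 1 * (ν+1))^j * (Nat.factorial j : ℝ)) ≤ 1) ∧
    memF (6 * Real.exp 1 * (ν+1)) (fun t : ℝ => ((ν+1)/2) * Real.log (1 + t^2/ν)) ∧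
    (∀ t : ℝ,
      Real.exp (-(((ν+1)/2) * Real.log (1 + t^2/ν)) +
        ((ν+1)/2) * Real.log (1 + (t/2)^2/ν)) ≤ 1) := by
  have hν0 : 0 < ν := by linarith
  refine ⟨fun n hn x => abs_iteratedDeriv_student_t_le hν hn x,
    fun n _ x => sum_abs_iteratedDeriv_student_t_le hν n x,
    ⟨?_, fun x n => sum_abs_iteratedDeriv_student_t_le hν n x⟩, fun t => ?_⟩
  · refine contDiff_const.mul (ContDiff.log (by fun_prop) fun t => ?_)
    positivity
  · rw [Real.exp_le_one_iff, neg_add_nonpos_iff]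
    have hsq : (t / 2) ^ 2 ≤ t ^ 2 := by nlinarith [sq_nonneg t]
    gcongr
end

section
/- Let f(x) = sech(x) = 2/(e^x + e^{−x}). Then for every integer n ≥ 1 and every x ∈ ℝ, |f^{(n)}(x)| ≤ 2·n!·(2e)^n; consequently, for every integer n ≥ 1 and every x ∈ ℝ, Σ_{j=1}^{n} |f^{(j)}(x)|/((8e)^j·j!) ≤ 1, so that f ∈ F(8e). -/
open MeasureTheory Real Filter

lemma one_le_norm_exp_add_exp_neg {z : ℂ} (hz : |z.im| ≤ 1) :
    1 ≤ ‖Complex.exp z + Complex.exp (-z)‖ := by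
  refine le_trans ?_ (Complex.re_le_norm _)
  have hcos : 1 / 2 ≤ Real.cos z.im := by
    have h := Real.one_sub_sq_div_two_le_cos (x := z.im)
    have : z.im ^ 2 ≤ 1 := (sq_le_one_iff_abs_le_one _).2 hz
    linarith
  have hexp : 2 ≤ Real.exp z.re + Real.exp (-z.re) := by
    linarith [Real.one_le_cosh z.re, Real.cosh_eq z.re]
  simp only [Complex.add_re, Complex.exp_re, Complex.neg_re, Complex.neg_im, Real.cos_neg]
  nlinarith

lemma analyticAt_two_div_exp_add_exp_neg {z : ℂ} (hz : |z.im| ≤ 1) :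
    AnalyticAt ℂ (fun w : ℂ => 2 / (Complex.exp w + Complex.exp (-w))) z := by
  have h0 : Complex.exp z + Complex.exp (-z) ≠ 0 :=
    norm_pos_iff.1 (zero_lt_one.trans_le (one_le_norm_exp_add_exp_neg hz))
  exact analyticAt_const.div (by fun_prop) h0

lemma iteratedDeriv_re_comp_ofReal {F : ℂ → ℂ} (hF : ∀ x : ℝ, AnalyticAt ℂ F x) (n : ℕ) (x : ℝ) :
    iteratedDeriv n (fun t : ℝ => (F t).re) x = (iteratedDeriv n F x).re := by
  induction n generalizing x with
  | zero => simp
  | succ n ih =>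
    rw [iteratedDeriv_succ, iteratedDeriv_succ, funext ih]
    have h := ((hF x).iterated_deriv n).differentiableAt.hasDerivAt
    rw [← iteratedDeriv_eq_iterate] at h
    exact h.real_of_complex.deriv

lemma two_div_exp_add_exp_neg_eq_re (t : ℝ) :
    2 / (Real.exp t + Real.exp (-t)) = (2 / (Complex.exp t + Complex.exp (-t))).re := by
  rw [← Complex.ofReal_re (2 / (Real.exp t + Real.exp (-t)))]
  push_cast
  rfl

lemma abs_iteratedDeriv_two_div_exp_add_exp_neg_le (n : ℕ) (x : ℝ) :
    |iteratedDeriv n (fun t : ℝ => 2 / (Real.exp t + Real.exp (-t))) x| ≤ 2 * n.factorial := by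
  have him : ∀ z ∈ Metric.closedBall (x : ℂ) 1, |z.im| ≤ 1 := fun z hz => by
    have h := (Complex.abs_im_le_norm (z - x)).trans (mem_closedBall_iff_norm.1 hz)
    simpa using h
  rw [funext two_div_exp_add_exp_neg_eq_re,
    iteratedDeriv_re_comp_ofReal (F := fun w => 2 / (Complex.exp w + Complex.exp (-w)))
      (fun y => analyticAt_two_div_exp_add_exp_neg (by simp))]
  refine (Complex.abs_re_le_norm _).trans ?_
  have h := Complex.norm_iteratedDeriv_le_of_forall_mem_sphere_norm_le n (c := (x : ℂ)) (C := 2)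
    (f := fun w => 2 / (Complex.exp w + Complex.exp (-w))) one_pos
    (DifferentiableOn.diffContOnCl_ball (U := Metric.closedBall (x : ℂ) 1)
      (fun z hz => (analyticAt_two_div_exp_add_exp_neg
        (him z hz)).differentiableAt.differentiableWithinAt) subset_rfl)
    (fun z hz => by
      have h1 := one_le_norm_exp_add_exp_neg (him z (Metric.sphere_subset_closedBall hz))
      rw [norm_div, Complex.norm_two]
      exact div_le_self zero_le_two h1)
  simpa [mul_comm] using h

lemma contDiff_two_div_exp_add_exp_neg {n : WithTop ℕ∞} :
    ContDiff ℝ n (fun t : ℝ => 2 / (Real.exp t + Real.exp (-t))) :=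
  contDiff_const.div (by fun_prop) fun t => by positivity

lemma sum_Icc_two_mul_one_div_four_pow_le (n : ℕ) :
    ∑ j ∈ Finset.Icc 1 n, 2 * (1 / 4 : ℝ) ^ j ≤ 1 := by
  have h : ∑ j ∈ Finset.Icc 1 n, 2 * (1 / 4 : ℝ) ^ j = 2 / 3 * (1 - (1 / 4) ^ n) := by
    induction n with
    | zero => simp
    | succ n ih => rw [Finset.sum_Icc_succ_top (by lia), ih]; ring
  have : (0 : ℝ) ≤ (1 / 4) ^ n := by positivity
  linarith

/-- the hyperbolic secant `f(x) = 2/(e^x + e^{−x})` has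
derivatives bounded by `2·n!·(2e)^n` and belongs to `F(8e)`. -/
theorem sech_globally_analytic :
    (∀ n : ℕ, 1 ≤ n → ∀ x : ℝ,
      |iteratedDeriv n (fun t : ℝ => 2 / (Real.exp t + Real.exp (-t))) x|
        ≤ 2 * (Nat.factorial n : ℝ) * (2 * Real.exp 1)^n) ∧
    (∀ n : ℕ, 1 ≤ n → ∀ x : ℝ,
      ∑ j ∈ Finset.Icc 1 n,
          |iteratedDeriv j (fun t : ℝ => 2 / (Real.exp t + Real.exp (-t))) x| /
            ((8 * Real.exp 1)^j * (Nat.factorial j : ℝ)) ≤ 1) ∧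
    memF (8 * Real.exp 1) (fun t : ℝ => 2 / (Real.exp t + Real.exp (-t))) := by
  have hbound (n : ℕ) (x : ℝ) :
      |iteratedDeriv n (fun t : ℝ => 2 / (Real.exp t + Real.exp (-t))) x|
        ≤ 2 * (Nat.factorial n : ℝ) * (2 * Real.exp 1) ^ n := by
    refine (abs_iteratedDeriv_two_div_exp_add_exp_neg_le n x).trans ?_
    refine le_mul_of_one_le_right (by positivity) (one_le_pow₀ ?_)
    linarith [Real.add_one_le_exp 1]
  have hsum (x : ℝ) (n : ℕ) :
      ∑ j ∈ Finset.Icc 1 n,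
          |iteratedDeriv j (fun t : ℝ => 2 / (Real.exp t + Real.exp (-t))) x| /
            ((8 * Real.exp 1) ^ j * (Nat.factorial j : ℝ)) ≤ 1 := by
    refine (Finset.sum_le_sum fun j _ => ?_).trans (sum_Icc_two_mul_one_div_four_pow_le n)
    rw [div_le_iff₀ (by positivity)]
    refine (hbound j x).trans_eq ?_
    rw [show 2 * Real.exp 1 = 1 / 4 * (8 * Real.exp 1) by ring, mul_pow]
    ring
  exact ⟨fun n _ x => hbound n x, fun n _ x => hsum x n, contDiff_two_div_exp_add_exp_neg, hsum⟩
end
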